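/- arXiv:1609.06484 — 2 statements merged into one kernel-verified Lean document; each statement's English description precedes it below -/
import Mathlib

section
/- Let p be a prime, d ≥ 1, and let R_1, …, R_d ∈ 𝔽_p[x] be pairwise distinct monic irreducible polynomials. For every integer r ≥ 1 there exist constants K > 0 and γ > 0 such that for every finite nonempty set D ⊆ ℕ^d, the number of minimal special R-polynomials Γ ∈ 𝔽_p[X_1, …, X_d] whose support is contained in D and has cardinality at most r is at most K · |D| · (1 + log(1 + diam D))^γ. -/
/-- The diameter of a finite set of exponent vectors in `ℕ^d`:
`max_{a,b ∈ D} max_i |a_i - b_i|`. -/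
def expDiam {d : ℕ} (D : Finset (Fin d →₀ ℕ)) : ℕ :=
  D.sup fun a => D.sup fun b => Finset.univ.sup fun i : Fin d => ((a i : ℤ) - (b i : ℤ)).natAbs

/-- `Γ` is a minimal special `R`-polynomial: it is special (`Γ(R₁,…,R_d) = 0`), nonzero, and
no proper nonempty sub-sum of its monomials is special. -/
def IsMinimalSpecial {p d : ℕ} (R : Fin d → Polynomial (ZMod p))
    (Γ : MvPolynomial (Fin d) (ZMod p)) : Prop :=
  MvPolynomial.aeval R Γ = 0 ∧ Γ ≠ 0 ∧
    ∀ S : Finset (Fin d →₀ ℕ), S ⊆ Γ.support → S.Nonempty → S ≠ Γ.support →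
      MvPolynomial.aeval R (∑ a ∈ S, MvPolynomial.monomial a (Γ.coeff a)) ≠ 0

section UnitEquation

open Finset

variable {K ι : Type*} [Field K] {d : ℕ}

/-- `E` is a homomorphism from `ℤ^d` to the multiplicative group of `K` such that `E b` is a
`p`-th power only if `b` is divisible by `p`. -/
structure IsFrobeniusIndependent (p : ℕ) (E : (Fin d → ℤ) → K) : Prop where
  map_zero : E 0 = 1
  map_add : ∀ a b, E (a + b) = E a * E b
  dvd_of_eq_pow : ∀ b z, E b = z ^ p → ∀ j, (p : ℤ) ∣ b j

namespace IsFrobeniusIndependent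

variable {p : ℕ} {E : (Fin d → ℤ) → K}

lemma ne_zero (hE : IsFrobeniusIndependent p E) (b : Fin d → ℤ) : E b ≠ 0 := by
  intro h
  have h1 := hE.map_add b (-b)
  rw [add_neg_cancel, hE.map_zero, h, zero_mul] at h1
  exact one_ne_zero h1

lemma map_sub (hE : IsFrobeniusIndependent p E) (a b : Fin d → ℤ) : E (a - b) = E a / E b := by
  rw [eq_div_iff (hE.ne_zero b), ← hE.map_add, sub_add_cancel]

lemma map_nsmul (hE : IsFrobeniusIndependent p E) (n : ℕ) (b : Fin d → ℤ) :
    E (n • b) = E b ^ n := by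
  induction n with
  | zero => simp [hE.map_zero]
  | succ n ih => rw [succ_nsmul, hE.map_add, ih, pow_succ]

lemma map_eq_emod_mul (hE : IsFrobeniusIndependent p E) (b : Fin d → ℤ) :
    E b = E (fun j => b j % p) * E (fun j => b j / p) ^ p := by
  rw [← hE.map_nsmul, ← hE.map_add]
  congr 1
  ext j
  simp [Int.emod_add_mul_ediv]

end IsFrobeniusIndependent

variable {p : ℕ} {E : (Fin d → ℤ) → K} {s : Finset ι} {o : ι} {f : ι → K} {N : ℕ}
  {b : ι → Fin d → ℤ}

/-- A residue class where the terms are not all `p`-th powers up to a common factor satisfies a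
further linear equation, not involving the term at `o`. -/
lemma exists_linear_relation [Fact p.Prime] [CharP K p]
    (hE : IsFrobeniusIndependent p E) (res : ι → Fin d → ℤ) (ho : res o = 0)
    (hres : ¬ ∀ i ∈ s, ∃ z, f i * E (res i) = f o * z ^ p) :
    ∃ c : ι → K, c o = 0 ∧ (∃ i ∈ s, c i ≠ 0) ∧
      ∀ b : ι → Fin d → ℤ, (fun i j => b i j % (p : ℤ)) = res →
        ∑ i ∈ s, f i * E (b i) = 0 → ∑ i ∈ s, c i * E (b i) = 0 := by
  push Not at hres
  obtain ⟨k, hk, hkz⟩ := hres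
  let L := (frobenius K p).fieldRange
  have hmem : f k * E (res k) ∉ Submodule.span L {f o} := by
    intro h
    obtain ⟨⟨_, z, rfl⟩, h⟩ := Submodule.mem_span_singleton.1 h
    apply hkz z
    rw [← h, mul_comm]
    rfl
  obtain ⟨φ, hφ, hker⟩ := Submodule.exists_le_ker_of_notMem hmem
  have hφo : φ (f o) = 0 := hker (Submodule.mem_span_singleton_self _)
  refine ⟨fun i => (φ (f i * E (res i)) : K) / E (res i), ?_, ⟨k, hk, ?_⟩, ?_⟩
  · simp [ho, hE.map_zero, hφo]
  · exact div_ne_zero (by simpa using hφ) (hE.ne_zero _)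
  · intro b hb hsum
    have h1 : ∀ i, E (b i) = E (res i) * E (fun j => b i j / p) ^ p := fun i => by
      rw [hE.map_eq_emod_mul (b i), show (fun j => b i j % (p : ℤ)) = res i from congrFun hb i]
    let w : ι → L := fun i => ⟨E (fun j => b i j / p) ^ p, _, rfl⟩
    have h2 : φ (∑ i ∈ s, f i * E (b i)) = ∑ i ∈ s, w i * φ (f i * E (res i)) := by
      rw [_root_.map_sum]
      refine sum_congr rfl fun i _ => ?_
      rw [← smul_eq_mul (w i), ← _root_.map_smul]
      congr 1
      rw [h1]
      change _ = E (fun j => b i j / p) ^ p * _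
      ring
    rw [hsum, _root_.map_zero] at h2
    have h3 := congrArg (fun x : L => (x : K)) h2
    simp only [ZeroMemClass.coe_zero, AddSubmonoidClass.coe_finsetSum, MulMemClass.coe_mul] at h3
    rw [h3]
    refine sum_congr rfl fun i _ => ?_
    rw [h1, div_mul_eq_mul_div, ← mul_assoc, mul_right_comm, mul_div_cancel_right₀ _ (hE.ne_zero _),
      mul_comm]

/-- A vanishing linear combination contains a minimal vanishing sub-sum. -/
lemma exists_minimal_zero_sum (hE : ∀ b, E b ≠ 0) {c : ι → K} (hc : ∃ i ∈ s, c i ≠ 0)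
    (hsum : ∑ i ∈ s, c i * E (b i) = 0) :
    ∃ I ⊆ s, 2 ≤ #I ∧ (∀ i ∈ I, c i ≠ 0) ∧ ∑ i ∈ I, c i * E (b i) = 0 ∧
      ∀ t ⊆ I, t.Nonempty → t ≠ I → ∑ i ∈ t, c i * E (b i) ≠ 0 := by
  classical
  obtain ⟨I, hI⟩ := exists_minimal_of_wellFoundedLT
    (fun t : Finset ι => t.Nonempty ∧ t ⊆ {i ∈ s | c i ≠ 0} ∧ ∑ i ∈ t, c i * E (b i) = 0)
    ⟨{i ∈ s | c i ≠ 0}, by simpa [Finset.Nonempty] using hc, subset_rfl, by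
      have : ∀ i ∈ s, c i * E (b i) ≠ 0 → c i ≠ 0 := fun i _ h => left_ne_zero_of_mul h
      rwa [sum_filter_of_ne this]⟩
  obtain ⟨⟨hne, hsub, h0⟩, hmin⟩ := hI
  have hcI : ∀ i ∈ I, c i ≠ 0 := fun i hi => (mem_filter.1 (hsub hi)).2
  refine ⟨I, hsub.trans (filter_subset _ _), ?_, hcI, h0, fun t ht htne hts h => ?_⟩
  · by_contra! hlt
    obtain ⟨i, rfl⟩ := card_eq_one.1 (le_antisymm (Nat.le_of_lt_succ hlt) hne.card_pos)
    rw [sum_singleton] at h0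
    exact mul_ne_zero (hcI i (mem_singleton_self i)) (hE _) h0
  · exact hts (ht.antisymm (hmin ⟨htne, ht.trans hsub, h⟩ ht))

variable [Fintype ι]

open Classical in
/-- The tuples of vectors in `ℤ^d` with all coordinates between `l` and `u`. -/
noncomputable def exponentBox (ι : Type*) [Fintype ι] (d : ℕ) (l u : ℤ) :
    Finset (ι → Fin d → ℤ) :=
  Finset.Icc (fun _ _ => l) (fun _ _ => u)

lemma mem_exponentBox {l u : ℤ} :
    b ∈ exponentBox ι d l u ↔ ∀ i j, l ≤ b i j ∧ b i j ≤ u := by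
  simp only [exponentBox, mem_Icc, Pi.le_def, forall_and]

open Classical in
/-- The non-degenerate solutions of `∑ i ∈ s, f i * E (b i) = 0`, normalized by `b o = 0`, with all
exponents bounded by `N`. -/
noncomputable def unitSolutions (E : (Fin d → ℤ) → K) (s : Finset ι) (o : ι)
    (f : ι → K) (N : ℕ) : Finset (ι → Fin d → ℤ) :=
  {b ∈ exponentBox ι d (-N) N |
    (∀ i ∉ s, b i = 0) ∧ b o = 0 ∧ ∑ i ∈ s, f i * E (b i) = 0 ∧
      ∀ t ⊆ s, t.Nonempty → t ≠ s → ∑ i ∈ t, f i * E (b i) ≠ 0}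

lemma mem_unitSolutions : b ∈ unitSolutions E s o f N ↔
    (∀ i j, |b i j| ≤ N) ∧ (∀ i ∉ s, b i = 0) ∧ b o = 0 ∧ ∑ i ∈ s, f i * E (b i) = 0 ∧
      ∀ t ⊆ s, t.Nonempty → t ≠ s → ∑ i ∈ t, f i * E (b i) ≠ 0 := by
  classical
  simp only [unitSolutions, mem_filter, mem_exponentBox, abs_le]

/-- Solutions in a fixed residue class, all of whose terms are `p`-th powers up to a common factor,
descend to solutions of half the size. -/
lemma card_filter_unitSolutions_le_of_forall_eq_pow [Fact p.Prime] [CharP K p]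
    (hE : IsFrobeniusIndependent p E) (hf : ∀ i ∈ s, f i ≠ 0) (ho : o ∈ s)
    (res : ι → Fin d → ℤ) (hres : ∀ i ∈ s, ∃ z, f i * E (res i) = f o * z ^ p) :
    ∃ g : ι → K, (∀ i ∈ s, g i ≠ 0) ∧
      #{b ∈ unitSolutions E s o f N | (fun i j => b i j % (p : ℤ)) = res} ≤
        #(unitSolutions E s o g ((N + 1) / 2)) := by
  classical
  have hp : p.Prime := Fact.out
  choose! g hg using hres
  refine ⟨g, fun i hi h0 => ?_, ?_⟩
  · have := hg i hi
    rw [h0, zero_pow hp.ne_zero, mul_zero] at this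
    exact mul_ne_zero (hf i hi) (hE.ne_zero _) this
  have key : ∀ b : ι → Fin d → ℤ, (fun i j => b i j % (p : ℤ)) = res → ∀ t ⊆ s,
      ∑ i ∈ t, f i * E (b i) = f o * (∑ i ∈ t, g i * E (fun j => b i j / p)) ^ p := by
    intro b hb t ht
    rw [sum_pow_char, mul_sum]
    refine sum_congr rfl fun i hi => ?_
    rw [hE.map_eq_emod_mul (b i), ← mul_assoc, show (fun j => b i j % (p : ℤ)) = res i from
      congrFun hb i, hg i (ht hi)]
    ring
  refine card_le_card_of_injOn (fun b i j => b i j / p) ?_ ?_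
  · intro b hb
    obtain ⟨hb, hbres⟩ := mem_filter.1 hb
    obtain ⟨hN, hz, h0, hsum, hmin⟩ := mem_unitSolutions.1 hb
    refine mem_unitSolutions.2 ⟨fun i j => ?_, fun i hi => ?_, ?_, ?_, fun t ht hne hts h => ?_⟩
    · have h1 := abs_le.1 (hN i j)
      have h2 : (2 : ℤ) ≤ p := by exact_mod_cast hp.two_le
      have h3 := Int.emod_add_mul_ediv (b i j) p
      have h4 := Int.emod_nonneg (b i j) (by omega : (p : ℤ) ≠ 0)
      have h5 := Int.emod_lt_of_pos (b i j) (by omega : (0 : ℤ) < p)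
      simp only
      generalize b i j / (p : ℤ) = q at *
      rw [abs_le]
      push_cast
      constructor
      · by_contra! hq
        have : 2 * q ≤ -(N : ℤ) - 2 := by omega
        have hq0 : q + 1 ≤ 0 := by omega
        nlinarith
      · by_contra! hq
        have hq0 : 0 ≤ q := by omega
        have : (N : ℤ) + 1 ≤ 2 * q := by omega
        nlinarith
    · ext j; simp [hz i hi]
    · ext j; simp [h0]
    · have := key b hbres s subset_rfl
      rw [hsum, zero_eq_mul] at this
      exact eq_zero_of_pow_eq_zero (this.resolve_left (hf o ho))
    · apply hmin t ht hne hts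
      rw [key b hbres t ht, h, zero_pow hp.ne_zero, mul_zero]
  · intro b hb b' hb' h
    have hb := (mem_filter.1 hb).2
    have hb' := (mem_filter.1 hb').2
    ext i j
    have h1 : b i j / (p : ℤ) = b' i j / p := congrFun (congrFun h i) j
    have h2 : b i j % (p : ℤ) = b' i j % p := by
      rw [show b i j % (p : ℤ) = res i j from congrFun (congrFun hb i) j,
        show b' i j % (p : ℤ) = res i j from congrFun (congrFun hb' i) j]
    rw [← Int.emod_add_mul_ediv (b i j) p, ← Int.emod_add_mul_ediv (b' i j) p, h1, h2]

/-- At most one residue class contains solutions all of whose terms are `p`-th powers up to a common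
factor. -/
lemma eq_of_forall_eq_pow
    (hE : IsFrobeniusIndependent p E) (hf : ∀ i ∈ s, f i ≠ 0) {N' : ℕ} {b' : ι → Fin d → ℤ}
    (hb : b ∈ unitSolutions E s o f N) (hb' : b' ∈ unitSolutions E s o f N')
    (hpow : ∀ i ∈ s, ∃ z, f i * E (fun j => b i j % p) = f o * z ^ p)
    (hpow' : ∀ i ∈ s, ∃ z, f i * E (fun j => b' i j % p) = f o * z ^ p) :
    (fun i j => b i j % (p : ℤ)) = fun i j => b' i j % p := by
  ext i j
  by_cases hi : i ∈ s
  · obtain ⟨z, hz⟩ := hpow i hi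
    obtain ⟨z', hz'⟩ := hpow' i hi
    have h1 : f i * E (fun j => b' i j % p) ≠ 0 := mul_ne_zero (hf i hi) (hE.ne_zero _)
    have := hE.dvd_of_eq_pow ((fun j => b i j % p) - fun j => b' i j % p) (z / z') (by
      rw [hE.map_sub, div_pow, ← mul_div_mul_left _ _ (hf i hi), hz, hz',
        mul_div_mul_left]
      rintro h0
      rw [hz', h0, zero_mul] at h1
      exact h1 rfl) j
    have h2 := Int.emod_emod_of_dvd (b i j) (dvd_refl (p : ℤ))
    have h3 := Int.emod_emod_of_dvd (b' i j) (dvd_refl (p : ℤ))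
    rw [← h2, ← h3]
    exact Int.emod_eq_emod_iff_emod_sub_eq_zero.2 (Int.emod_eq_zero_of_dvd this)
  · simp [(mem_unitSolutions.1 hb).2.1 i hi, (mem_unitSolutions.1 hb').2.1 i hi]

open Classical in
/-- Solutions with a vanishing sub-relation indexed by `I` are counted by the solutions of that
sub-relation and the solutions of the equation where the terms in `I` are merged into one. -/
lemma card_filter_unitSolutions_le_mul (hE : IsFrobeniusIndependent p E) (hf : ∀ i ∈ s, f i ≠ 0)
    (ho : o ∈ s) {I : Finset ι} (hI : I ⊆ s) (hoI : o ∉ I) {i₀ : ι} (hi₀ : i₀ ∈ I) (c : ι → K)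
    {A : ℕ} (hA : ∀ g : ι → K, (∀ i ∈ insert i₀ (s \ I), g i ≠ 0) →
      #(unitSolutions E (insert i₀ (s \ I)) o g N) ≤ A) :
    #{b ∈ unitSolutions E s o f N | ∑ i ∈ I, c i * E (b i) = 0 ∧
        ∀ t ⊆ I, t.Nonempty → t ≠ I → ∑ i ∈ t, c i * E (b i) ≠ 0} ≤
      A * #(unitSolutions E I i₀ c (2 * N)) := by
  have hIs : I ≠ s := fun h => hoI (h ▸ ho)
  have hio : i₀ ≠ o := fun h => hoI (h ▸ hi₀)
  have hshift : ∀ (b : ι → Fin d → ℤ) (a : ι → K), ∀ t ⊆ I, ∑ i ∈ t, a i * E (b i) =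
      E (b i₀) * ∑ i ∈ t, a i * E (if i ∈ I then b i - b i₀ else 0) := by
    intro b a t ht
    rw [mul_sum]
    refine sum_congr rfl fun i hi => ?_
    rw [if_pos (ht hi), hE.map_sub]
    field_simp [hE.ne_zero (b i₀)]
  refine card_le_mul_card_image_of_maps_to
    (f := fun b i => if i ∈ I then b i - b i₀ else 0) ?_ A ?_
  · intro b hb
    obtain ⟨hb, hc0, hcm⟩ := mem_filter.1 hb
    obtain ⟨hN, hz, h0, hsum, hmin⟩ := mem_unitSolutions.1 hb
    refine mem_unitSolutions.2 ⟨fun i j => ?_, fun i hi => ?_, ?_, ?_, fun t ht hne hts h => ?_⟩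
    · split_ifs
      · have h1 := abs_le.1 (hN i j)
        have h2 := abs_le.1 (hN i₀ j)
        rw [Pi.sub_apply, abs_le]
        push_cast
        constructor <;> linarith
      · simp
    · simp [hi]
    · simp
    · rw [hshift b c I subset_rfl] at hc0
      exact (mul_eq_zero.1 hc0).resolve_left (hE.ne_zero _)
    · apply hcm t ht hne hts
      rw [hshift b c t ht, h, mul_zero]
  · intro τ _
    rcases ({b ∈ ({b ∈ unitSolutions E s o f N | ∑ i ∈ I, c i * E (b i) = 0 ∧
        ∀ t ⊆ I, t.Nonempty → t ≠ I → ∑ i ∈ t, c i * E (b i) ≠ 0} : Finset _) |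
        (fun i => if i ∈ I then b i - b i₀ else 0) = τ} : Finset _).eq_empty_or_nonempty with
      h | ⟨b₀, hb₀⟩
    · rw [h]; simp
    set F := ∑ i ∈ I, f i * E (τ i) with hF
    let g : ι → K := fun i => if i = i₀ then F else f i
    have hmerge : ∀ b : ι → Fin d → ℤ, (fun i => if i ∈ I then b i - b i₀ else 0) = τ →
        E (b i₀) * F = ∑ i ∈ I, f i * E (b i) := by
      rintro b rfl
      exact (hshift b f I subset_rfl).symm
    have hF0 : F ≠ 0 := by
      obtain ⟨hb₀, hτ⟩ := mem_filter.1 hb₀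
      obtain ⟨-, -, -, -, hmin⟩ := mem_unitSolutions.1 (mem_filter.1 hb₀).1
      intro h
      apply hmin I hI ⟨i₀, hi₀⟩ hIs
      rw [← hmerge b₀ hτ, h, mul_zero]
    have hsumg : ∀ b : ι → Fin d → ℤ, (fun i => if i ∈ I then b i - b i₀ else 0) = τ →
        ∀ t ⊆ insert i₀ (s \ I), ∑ i ∈ t, g i * E (if i ∈ insert i₀ (s \ I) then b i else 0) =
          ∑ i ∈ (if i₀ ∈ t then t.erase i₀ ∪ I else t), f i * E (b i) := by
      intro b hb t ht
      have hne : ∀ u ⊆ t, i₀ ∉ u → ∑ i ∈ u, g i * E (if i ∈ insert i₀ (s \ I) then b i else 0) =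
          ∑ i ∈ u, f i * E (b i) := by
        intro u hu hiu
        refine sum_congr rfl fun i hi => ?_
        rw [if_pos (ht (hu hi))]
        simp only [g]
        rw [if_neg (show i ≠ i₀ from fun h => hiu (h ▸ hi))]
      split_ifs with hit
      · rw [sum_union, ← hmerge b hb, ← hne _ (erase_subset _ _) (notMem_erase _ _),
          ← sum_erase_add _ _ hit]
        · simp [g, mul_comm]
        · rw [disjoint_left]
          intro i hi hiI
          have := ht (mem_of_mem_erase hi)
          simp only [mem_insert, mem_sdiff] at this
          exact this.elim (ne_of_mem_erase hi) (fun h => h.2 hiI)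
      · exact hne t subset_rfl hit
    refine le_trans (card_le_card_of_injOn
      (fun b i => if i ∈ insert i₀ (s \ I) then b i else 0) ?_ ?_) (hA g ?_)
    · intro b hb
      obtain ⟨hb, hτ⟩ := mem_filter.1 hb
      obtain ⟨hN, hz, h0, hsum, hmin⟩ := mem_unitSolutions.1 (mem_filter.1 hb).1
      refine mem_unitSolutions.2 ⟨fun i j => ?_, fun i hi => ?_, ?_, ?_, fun t ht hne hts => ?_⟩
      · simp only
        split_ifs
        · exact hN i j
        · simp
      · simp only [if_neg hi]
      · simp [h0]
      · rw [hsumg b hτ _ subset_rfl, if_pos (mem_insert_self _ _), erase_insert (by simp [hi₀]),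
          sdiff_union_of_subset hI, hsum]
      · rw [hsumg b hτ t ht]
        split_ifs with hit
        · refine hmin _ ?_ ⟨i₀, mem_union_right _ hi₀⟩ ?_
          · refine union_subset (fun i hi => ?_) hI
            have := ht (mem_of_mem_erase hi)
            simp only [mem_insert, mem_sdiff] at this
            exact this.elim (fun h => absurd h (ne_of_mem_erase hi)) (fun h => h.1)
          · intro h
            refine hts (ht.antisymm fun i hi => ?_)
            rcases mem_insert.1 hi with rfl | hi
            · exact hit
            · have := (mem_sdiff.1 hi).1
              rw [← h, mem_union] at this
              exact mem_of_mem_erase (this.resolve_right (mem_sdiff.1 hi).2)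
        · refine hmin _ (fun i hi => ?_) hne ?_
          · have := ht hi
            simp only [mem_insert, mem_sdiff] at this
            exact this.elim (fun h => absurd (by rwa [h] at hi) hit) (fun h => h.1)
          · rintro rfl
            exact hit (hI hi₀)
    · intro b hb b' hb' h
      obtain ⟨hb, hτ⟩ := mem_filter.1 hb
      obtain ⟨hb', hτ'⟩ := mem_filter.1 hb'
      have hz := (mem_unitSolutions.1 (mem_filter.1 hb).1).2.1
      have hz' := (mem_unitSolutions.1 (mem_filter.1 hb').1).2.1
      have hJ : ∀ i ∈ insert i₀ (s \ I), b i = b' i := fun i hi => by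
        have := congrFun h i
        simpa only [if_pos hi] using this
      ext1 i
      by_cases hiI : i ∈ I
      · have := congrFun (hτ.trans hτ'.symm) i
        simp only [if_pos hiI, hJ i₀ (mem_insert_self _ _)] at this
        exact sub_left_injective this
      · by_cases his : i ∈ s
        · exact hJ i (mem_insert_of_mem (mem_sdiff.2 ⟨his, hiI⟩))
        · rw [hz i his, hz' i his]
    · intro i hi
      simp only [g]
      split_ifs with h
      · exact hF0
      · exact hf i (mem_sdiff.1 ((mem_insert.1 hi).resolve_left h)).1

/-- Bound for the solutions in a residue class where the terms are not all `p`-th powers up to a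
common factor, in terms of bounds for equations with fewer terms. -/
lemma card_filter_unitSolutions_le_of_not_forall_eq_pow [Fact p.Prime] [CharP K p]
    (hE : IsFrobeniusIndependent p E) (hf : ∀ i ∈ s, f i ≠ 0) (ho : o ∈ s)
    (res : ι → Fin d → ℤ) (hres : ¬ ∀ i ∈ s, ∃ z, f i * E (res i) = f o * z ^ p) {A B : ℕ}
    (hA : ∀ t : Finset ι, #t < #s → ∀ o ∈ t, ∀ g : ι → K, (∀ i ∈ t, g i ≠ 0) →
      #(unitSolutions E t o g N) ≤ A)
    (hB : ∀ t : Finset ι, #t < #s → ∀ o ∈ t, ∀ g : ι → K, (∀ i ∈ t, g i ≠ 0) →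
      #(unitSolutions E t o g (2 * N)) ≤ B) :
    #{b ∈ unitSolutions E s o f N | (fun i j => b i j % (p : ℤ)) = res} ≤
      Fintype.card (Finset ι × ι) * (A * B) := by
  classical
  rcases ({b ∈ unitSolutions E s o f N | (fun i j => b i j % (p : ℤ)) = res} :
    Finset _).eq_empty_or_nonempty with h | ⟨b₀, hb₀⟩
  · rw [h]; simp
  have hro : res o = 0 := by
    obtain ⟨hb₀, hr⟩ := mem_filter.1 hb₀
    obtain ⟨-, -, h0, -⟩ := mem_unitSolutions.1 hb₀
    ext j
    rw [← hr]
    simp [h0]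
  obtain ⟨c, hco, hcs, hc⟩ := exists_linear_relation hE res hro hres
  let X : Finset ι × ι → Finset (ι → Fin d → ℤ) := fun x =>
    {b ∈ unitSolutions E s o f N | (x.1 ⊆ s ∧ 2 ≤ #x.1 ∧ (∀ i ∈ x.1, c i ≠ 0) ∧ x.2 ∈ x.1) ∧
      ∑ i ∈ x.1, c i * E (b i) = 0 ∧
        ∀ t ⊆ x.1, t.Nonempty → t ≠ x.1 → ∑ i ∈ t, c i * E (b i) ≠ 0}
  have hsub : ({b ∈ unitSolutions E s o f N | (fun i j => b i j % (p : ℤ)) = res} : Finset _) ⊆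
      univ.biUnion X := by
    intro b hb
    obtain ⟨hb, hbr⟩ := mem_filter.1 hb
    obtain ⟨I, hIs, hI2, hIc, h0, hmin⟩ := exists_minimal_zero_sum (b := b) hE.ne_zero hcs
      (hc b hbr (mem_unitSolutions.1 hb).2.2.2.1)
    obtain ⟨i₀, hi₀⟩ := card_pos.1 (two_pos.trans_le hI2)
    exact mem_biUnion.2 ⟨(I, i₀), mem_univ _, mem_filter.2 ⟨hb, ⟨hIs, hI2, hIc, hi₀⟩, h0, hmin⟩⟩
  refine (card_le_card hsub).trans (card_biUnion_le_card_mul _ _ _ ?_)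
  rintro ⟨I, i₀⟩ -
  by_cases hx : I ⊆ s ∧ 2 ≤ #I ∧ (∀ i ∈ I, c i ≠ 0) ∧ i₀ ∈ I
  · obtain ⟨hIs, hI2, hIc, hi₀⟩ := hx
    have hoI : o ∉ I := fun h => hIc o h hco
    have hcard : #(insert i₀ (s \ I)) < #s := by
      rw [card_insert_of_notMem (by simp [hi₀]), card_sdiff_of_subset hIs]
      have := card_le_card hIs
      omega
    have hIlt : #I < #s := card_lt_card (hIs.ssubset_of_ne fun h => hoI (h ▸ ho))
    have h1 := card_filter_unitSolutions_le_mul hE hf ho hIs hoI hi₀ c (N := N) (A := A)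
      (hA _ hcard o (mem_insert_of_mem (mem_sdiff.2 ⟨ho, hoI⟩)))
    refine le_trans (le_of_eq ?_) (h1.trans (Nat.mul_le_mul_left A (hB I hIlt i₀ hi₀ c hIc)))
    simp only [X]
    congr 1
    ext b
    simp only [mem_filter]
    exact and_congr_right fun _ => and_iff_right ⟨hIs, hI2, hIc, hi₀⟩
  · have : X (I, i₀) = ∅ := filter_eq_empty_iff.2 fun b _ h => hx h.1
    rw [this]; simp

/-- One step of the recursion bounding the number of solutions. -/
lemma card_unitSolutions_le_add [Fact p.Prime] [CharP K p]
    (hE : IsFrobeniusIndependent p E) (hf : ∀ i ∈ s, f i ≠ 0) (ho : o ∈ s) {A B : ℕ}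
    (hA : ∀ t : Finset ι, #t < #s → ∀ o ∈ t, ∀ g : ι → K, (∀ i ∈ t, g i ≠ 0) →
      #(unitSolutions E t o g N) ≤ A)
    (hB : ∀ t : Finset ι, #t < #s → ∀ o ∈ t, ∀ g : ι → K, (∀ i ∈ t, g i ≠ 0) →
      #(unitSolutions E t o g (2 * N)) ≤ B) :
    ∃ g : ι → K, (∀ i ∈ s, g i ≠ 0) ∧ #(unitSolutions E s o f N) ≤
      #(unitSolutions E s o g ((N + 1) / 2)) +
        #(exponentBox ι d 0 p) *
          (Fintype.card (Finset ι × ι) * (A * B)) := by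
  classical
  set P : (ι → Fin d → ℤ) → Prop := fun res => ∀ i ∈ s, ∃ z, f i * E (res i) = f o * z ^ p with hP
  set S := unitSolutions E s o f N with hS
  let red : (ι → Fin d → ℤ) → ι → Fin d → ℤ := fun b i j => b i j % p
  have hbad : #{b ∈ S | ¬ P (red b)} ≤
      #(exponentBox ι d 0 p) *
          (Fintype.card (Finset ι × ι) * (A * B)) := by
    rw [mul_comm]
    refine card_le_mul_card_image_of_maps_to (f := red) ?_ _ ?_
    · intro b _
      have hp : (0 : ℤ) < p := by exact_mod_cast (Fact.out : p.Prime).pos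
      exact mem_exponentBox.2 fun i j => ⟨Int.emod_nonneg _ hp.ne', (Int.emod_lt_of_pos _ hp).le⟩
    · intro res _
      by_cases hres : P res
      · rw [filter_eq_empty_iff.2]
        · simp
        · rintro b hb rfl
          exact (mem_filter.1 hb).2 hres
      · refine le_trans (card_le_card ?_)
          (card_filter_unitSolutions_le_of_not_forall_eq_pow hE hf ho res hres hA hB)
        exact filter_subset_filter _ (filter_subset _ _)
  have hsplit : #S = #{b ∈ S | P (red b)} + #{b ∈ S | ¬ P (red b)} :=
    (card_filter_add_card_filter_not _).symm
  rcases ({b ∈ S | P (red b)} : Finset _).eq_empty_or_nonempty with h | ⟨b₀, hb₀⟩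
  · refine ⟨f, hf, ?_⟩
    rw [h, card_empty, zero_add] at hsplit
    omega
  · obtain ⟨hb₀, hP₀⟩ := mem_filter.1 hb₀
    obtain ⟨g, hg, hle⟩ := card_filter_unitSolutions_le_of_forall_eq_pow (N := N) hE hf ho
      (red b₀) hP₀
    refine ⟨g, hg, ?_⟩
    have : #{b ∈ S | P (red b)} ≤ #{b ∈ S | red b = red b₀} := by
      refine card_le_card fun b hb => ?_
      obtain ⟨hb, hPb⟩ := mem_filter.1 hb
      exact mem_filter.2 ⟨hb, eq_of_forall_eq_pow hE hf hb hb₀ hPb hP₀⟩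
    have h2 : #{b ∈ S | red b = red b₀} ≤ #(unitSolutions E s o g ((N + 1) / 2)) := by
      convert hle
    omega

lemma clog_two_mul_le (N : ℕ) : Nat.clog 2 (2 * N) ≤ Nat.clog 2 N + 1 := by
  rw [Nat.clog_le_iff_le_pow one_lt_two, pow_succ']
  exact Nat.mul_le_mul_left 2 (Nat.le_pow_clog one_lt_two N)

/-- The number of non-degenerate solutions of a linear equation in the values of `E` is bounded by a
power of the logarithm of the size, uniformly in the coefficients of the equation. -/
theorem exists_card_unitSolutions_le [Fact p.Prime] [CharP K p]
    (hE : IsFrobeniusIndependent p E) (n : ℕ) :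
    ∃ C k : ℕ, ∀ s : Finset ι, #s ≤ n → ∀ o ∈ s, ∀ f : ι → K, (∀ i ∈ s, f i ≠ 0) → ∀ N,
      #(unitSolutions E s o f N) ≤ C * (Nat.clog 2 N + 1) ^ k := by
  induction n with
  | zero =>
    refine ⟨0, 0, fun s hs o ho => ?_⟩
    rw [Nat.le_zero, card_eq_zero] at hs
    simp [hs] at ho
  | succ n ih =>
    obtain ⟨C, k, ih⟩ := ih
    set Q := #(exponentBox ι d 0 p) *
          (Fintype.card (Finset ι × ι) * (C * (C * 2 ^ k))) with hQ
    set B₀ := #(exponentBox ι d (-1) 1) with hB₀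
    have hstep : ∀ s : Finset ι, #s ≤ n + 1 → ∀ o ∈ s, ∀ N, ∀ f : ι → K, (∀ i ∈ s, f i ≠ 0) →
        #(unitSolutions E s o f N) ≤ B₀ + Q * (Nat.clog 2 N * (Nat.clog 2 N + 1) ^ (2 * k)) := by
      intro s hs o ho N
      induction N using Nat.strong_induction_on with
      | _ N ihN =>
        intro f hf
        rcases Nat.lt_or_ge N 2 with hN | hN
        · refine le_add_right (card_le_card fun b hb => ?_)
          have hb := (mem_unitSolutions.1 hb).1
          have hN' : (N : ℤ) ≤ 1 := by omega
          exact mem_exponentBox.2 fun i j => abs_le.1 ((hb i j).trans hN')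
        · have hlt : ∀ t : Finset ι, #t < #s → #t ≤ n := fun t ht => by omega
          obtain ⟨g, hg, hle⟩ := card_unitSolutions_le_add (N := N) hE hf ho
            (fun t ht o ho g hg => ih t (hlt t ht) o ho g hg N)
            (fun t ht o ho g hg => ih t (hlt t ht) o ho g hg (2 * N))
          have h1 := ihN ((N + 1) / 2) (by omega) g hg
          have h2 : Nat.clog 2 N = Nat.clog 2 ((N + 1) / 2) + 1 := Nat.clog_of_two_le one_lt_two hN
          set l := Nat.clog 2 ((N + 1) / 2) with hl
          have h3 : Nat.clog 2 (2 * N) + 1 ≤ 2 * (l + 1 + 1) := by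
            have := clog_two_mul_le N
            omega
          rw [h2] at hle ⊢
          have h4 : C * (l + 1 + 1) ^ k * (C * (Nat.clog 2 (2 * N) + 1) ^ k) ≤
              C * (C * 2 ^ k) * (l + 1 + 1) ^ (2 * k) := by
            calc _ ≤ C * (l + 1 + 1) ^ k * (C * (2 * (l + 1 + 1)) ^ k) := by gcongr
              _ = _ := by rw [mul_pow]; ring
          have h5 : (l + 1) ^ (2 * k) ≤ (l + 1 + 1) ^ (2 * k) :=
            Nat.pow_le_pow_left (Nat.le_succ _) _
          calc _ ≤ _ := hle
            _ ≤ (B₀ + Q * (l * (l + 1) ^ (2 * k))) +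
                #(exponentBox ι d 0 p) *
                (Fintype.card (Finset ι × ι) * (C * (C * 2 ^ k) * (l + 1 + 1) ^ (2 * k))) := by
              gcongr
            _ = B₀ + Q * (l * (l + 1) ^ (2 * k) + (l + 1 + 1) ^ (2 * k)) := by rw [hQ]; ring
            _ ≤ B₀ + Q * (l * (l + 1 + 1) ^ (2 * k) + (l + 1 + 1) ^ (2 * k)) := by gcongr
            _ = _ := by ring
    refine ⟨B₀ + Q, 2 * k + 1, fun s hs o ho f hf N => (hstep s hs o ho N f hf).trans ?_⟩
    rw [add_mul]
    refine add_le_add (Nat.le_mul_of_pos_right _ (by positivity)) (Nat.mul_le_mul_left _ ?_)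
    rw [pow_succ']
    exact Nat.mul_le_mul_right _ (Nat.le_succ _)

end UnitEquation

section PolynomialValues

open Polynomial IsDedekindDomain

/-- For pairwise non-associated primes `R j`, an integral power product of the `R j` which is an
`n`-th power in the fraction field has all its exponents divisible by `n`. -/
lemma dvd_of_prod_zpow_eq_pow {A K : Type*} [CommRing A] [IsDomain A] [IsPrincipalIdealRing A]
    [Field K] [Algebra A K] [IsFractionRing A K] {d : ℕ} {R : Fin d → A} (hR : ∀ j, Prime (R j))
    (hdvd : ∀ i j, R j ∣ R i → i = j) {n : ℕ} (hn : n ≠ 0) {b : Fin d → ℤ} {z : K}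
    (h : ∏ j, algebraMap A K (R j) ^ b j = z ^ n) (j : Fin d) : (n : ℤ) ∣ b j := by
  let v : HeightOneSpectrum A := ⟨Ideal.span {R j},
    (Ideal.span_singleton_prime (hR j).ne_zero).2 (hR j), by
      simpa using (hR j).ne_zero⟩
  have hself : v.valuation K (algebraMap A K (R j)) = WithZero.exp (-1 : ℤ) := by
    rw [HeightOneSpectrum.valuation_of_algebraMap,
      HeightOneSpectrum.intValuation_eq_exp_neg_multiplicity _ (hR j).ne_zero]
    have : multiplicity v.asIdeal (Ideal.span {R j}) = 1 := by
      refine multiplicity_eq_of_dvd_of_not_dvd (by simp [v]) ?_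
      simp only [v]
      rw [Ideal.span_singleton_pow, Ideal.dvd_span_singleton, Ideal.mem_span_singleton]
      intro h
      have := (pow_dvd_pow_iff (hR j).ne_zero (hR j).not_isUnit (n := 2) (m := 1)).1
        (by simpa using h)
      omega
    rw [this]
    simp
  have hother : ∀ i, i ≠ j → v.valuation K (algebraMap A K (R i)) = 1 := by
    intro i hij
    rw [HeightOneSpectrum.valuation_eq_one_iff_notMem]
    simp only [v, Ideal.mem_span_singleton]
    exact fun h => hij (hdvd i j h)
  have h1 := congrArg (v.valuation K) h
  rw [map_prod, Finset.prod_eq_single j, map_zpow₀, hself, map_pow] at h1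
  · have hz : v.valuation K z ≠ 0 := by
      intro h0
      rw [h0, zero_pow hn] at h1
      exact zpow_ne_zero _ WithZero.exp_ne_zero h1
    have h2 := congrArg WithZero.log h1
    rw [WithZero.log_zpow, WithZero.log_pow, WithZero.log_exp] at h2
    refine ⟨-WithZero.log (v.valuation K z), ?_⟩
    simp only [smul_eq_mul, nsmul_eq_mul] at h2
    linarith
  · intro i _ hij
    rw [map_zpow₀, hother i hij, one_zpow]
  · simp

lemma isFrobeniusIndependent_prod_zpow {p : ℕ} [Fact p.Prime] {d : ℕ}
    {R : Fin d → Polynomial (ZMod p)} (hR : ∀ j, (R j).Monic ∧ Irreducible (R j))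
    (hinj : Function.Injective R) :
    IsFrobeniusIndependent p fun b : Fin d → ℤ =>
      ∏ j, algebraMap (ZMod p)[X] (RatFunc (ZMod p)) (R j) ^ b j where
  map_zero := by simp
  map_add a b := by
    rw [← Finset.prod_mul_distrib]
    refine Finset.prod_congr rfl fun j _ => ?_
    rw [Pi.add_apply, zpow_add₀]
    simpa using (hR j).1.ne_zero
  dvd_of_eq_pow b z h := by
    refine dvd_of_prod_zpow_eq_pow (fun j => (hR j).2.prime) (fun i j hij => hinj ?_)
      (Fact.out : p.Prime).ne_zero h
    exact eq_of_monic_of_associated (hR i).1 (hR j).1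
      ((hR j).2.associated_of_dvd (hR i).2 hij).symm

lemma natAbs_sub_le_expDiam {d : ℕ} {D : Finset (Fin d →₀ ℕ)} {a b : Fin d →₀ ℕ} (ha : a ∈ D)
    (hb : b ∈ D) (i : Fin d) : ((a i : ℤ) - (b i : ℤ)).natAbs ≤ expDiam D :=
  (Finset.le_sup (f := fun i : Fin d => ((a i : ℤ) - (b i : ℤ)).natAbs) (Finset.mem_univ i)).trans
    ((Finset.le_sup (f := fun b : Fin d →₀ ℕ =>
      Finset.univ.sup fun i : Fin d => ((a i : ℤ) - (b i : ℤ)).natAbs) hb).trans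
      (Finset.le_sup (f := fun a : Fin d →₀ ℕ => D.sup fun b =>
        Finset.univ.sup fun i : Fin d => ((a i : ℤ) - (b i : ℤ)).natAbs) ha))

/-- The polynomial with coefficients `c i` at the exponents `a + b i`, for `i ∈ s`. -/
noncomputable def translatedPolynomial {p d r : ℕ} (a : Fin d →₀ ℕ) (s : Finset (Fin r))
    (c : Fin r → ZMod p) (b : Fin r → Fin d → ℤ) : MvPolynomial (Fin d) (ZMod p) :=
  ∑ i ∈ s, MvPolynomial.monomial
    (Finsupp.equivFunOnFinite.symm fun j => ((a j : ℤ) + b i j).toNat) (c i)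

/-- Every minimal special polynomial with support in `D` arises, by translation by an element of
`D`, from a non-degenerate solution of a linear equation in power products of the `R j`. -/
lemma IsMinimalSpecial.exists_eq_translatedPolynomial {p : ℕ} [Fact p.Prime] {d r : ℕ}
    {R : Fin d → Polynomial (ZMod p)} (hR : ∀ j, R j ≠ 0) {D : Finset (Fin d →₀ ℕ)}
    {Γ : MvPolynomial (Fin d) (ZMod p)} (hΓ : IsMinimalSpecial R Γ) (hD : Γ.support ⊆ D)
    (hr : Γ.support.card ≤ r) :
    ∃ a ∈ D, ∃ s : Finset (Fin r), ∃ o ∈ s, ∃ c : Fin r → ZMod p, (∀ i ∈ s, c i ≠ 0) ∧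
      ∃ b ∈ unitSolutions (fun b : Fin d → ℤ =>
          ∏ j, algebraMap (ZMod p)[X] (RatFunc (ZMod p)) (R j) ^ b j) s o
          (fun i => algebraMap (ZMod p)[X] (RatFunc (ZMod p)) (C (c i))) (expDiam D),
        Γ = translatedPolynomial a s c b := by
  classical
  obtain ⟨hsp, hne, hmin⟩ := hΓ
  obtain ⟨φ⟩ : Nonempty (Γ.support ↪ Fin r) :=
    Function.Embedding.nonempty_of_card_le (by simpa using hr)
  set s : Finset (Fin r) := Finset.univ.map φ with hs
  let v : Fin r → Fin d →₀ ℕ := Function.extend φ (fun x => (x : Fin d →₀ ℕ)) 0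
  have hv : ∀ x, v (φ x) = x := fun x => φ.injective.extend_apply _ _ x
  have hmem : ∀ i ∈ s, ∃ x, φ x = i := fun i hi => by simpa [hs] using hi
  have hvs : ∀ i ∈ s, v i ∈ Γ.support := by
    intro i hi
    obtain ⟨x, rfl⟩ := hmem i hi
    rw [hv]
    exact x.2
  have hvinj : Set.InjOn v s := by
    intro i hi k hk h
    obtain ⟨x, rfl⟩ := hmem i hi
    obtain ⟨y, rfl⟩ := hmem k hk
    rw [hv, hv] at h
    rw [Subtype.ext h]
  have himage : s.image v = Γ.support := by
    refine subset_antisymm (Finset.image_subset_iff.2 hvs) fun x hx => ?_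
    exact Finset.mem_image.2 ⟨φ ⟨x, hx⟩, by simp [hs], hv ⟨x, hx⟩⟩
  obtain ⟨x₀, hx₀⟩ := MvPolynomial.support_nonempty.2 hne
  rw [← himage, Finset.mem_image] at hx₀
  obtain ⟨o, ho, -⟩ := hx₀
  let c : Fin r → ZMod p := fun i => Γ.coeff (v i)
  let b : Fin r → Fin d → ℤ := fun i j => if i ∈ s then (v i j : ℤ) - v o j else 0
  set ψ := algebraMap (ZMod p)[X] (RatFunc (ZMod p)) with hψ
  have hψR : ∀ j, ψ (R j) ≠ 0 := fun j => by simpa [hψ] using hR j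
  have hsumΓ : ∀ t ⊆ s, ∑ a ∈ t.image v, MvPolynomial.monomial a (Γ.coeff a) =
      ∑ i ∈ t, MvPolynomial.monomial (v i) (c i) := fun t ht =>
    Finset.sum_image (hvinj.mono (by exact_mod_cast ht))
  have hval : ∀ t ⊆ s, ψ (MvPolynomial.aeval R
      (∑ a ∈ t.image v, MvPolynomial.monomial a (Γ.coeff a))) =
      (∏ j, ψ (R j) ^ v o j) * ∑ i ∈ t, ψ (C (c i)) * ∏ j, ψ (R j) ^ b i j := by
    intro t ht
    rw [hsumΓ t ht, map_sum, map_sum, Finset.mul_sum]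
    refine Finset.sum_congr rfl fun i hi => ?_
    rw [MvPolynomial.aeval_monomial, map_mul, Finsupp.prod_fintype _ _ (by simp), map_prod,
      mul_left_comm, ← Finset.prod_mul_distrib]
    congr 1
    refine Finset.prod_congr rfl fun j _ => ?_
    simp only [b, if_pos (ht hi)]
    rw [zpow_sub₀ (hψR j), zpow_natCast, zpow_natCast, map_pow,
      mul_div_cancel₀ _ (pow_ne_zero _ (hψR j))]
  have hprod : (∏ j, ψ (R j) ^ v o j) ≠ 0 :=
    Finset.prod_ne_zero_iff.2 fun j _ => pow_ne_zero _ (hψR j)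
  refine ⟨v o, hD (hvs o ho), s, o, ho, c, fun i hi => MvPolynomial.mem_support_iff.1 (hvs i hi),
    b, mem_unitSolutions.2 ⟨fun i j => ?_, fun i hi => ?_, ?_, ?_, fun t ht htne hts h => ?_⟩, ?_⟩
  · simp only [b]
    split_ifs with hi
    · rw [Int.abs_eq_natAbs]
      exact_mod_cast natAbs_sub_le_expDiam (hD (hvs i hi)) (hD (hvs o ho)) j
    · simp
  · ext j
    simp [b, hi]
  · ext j
    simp [b]
  · have := hval s subset_rfl
    rw [himage, ← MvPolynomial.as_sum, hsp, map_zero] at this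
    exact (mul_eq_zero.1 this.symm).resolve_left hprod
  · refine hmin (t.image v) (himage ▸ Finset.image_subset_image ht) (htne.image v) ?_ ?_
    · intro heq
      apply hts
      have h1 := congrArg Finset.card (heq.trans himage.symm)
      rw [Finset.card_image_of_injOn (hvinj.mono (by exact_mod_cast ht)),
        Finset.card_image_of_injOn hvinj] at h1
      exact Finset.eq_of_subset_of_card_le ht h1.ge
    · have := hval t ht
      rw [h, mul_zero] at this
      exact (map_eq_zero_iff ψ (IsFractionRing.injective _ _)).1 this
  · have h1 := MvPolynomial.as_sum Γ
    rw [← himage, hsumΓ s subset_rfl] at h1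
    refine h1.trans (Finset.sum_congr rfl fun i hi => ?_)
    congr 1
    ext j
    simp [b, hi]

lemma clog_add_one_le_log (N : ℕ) :
    ((Nat.clog 2 N + 1 : ℕ) : ℝ) ≤ 2 * (1 + Real.log (1 + (N : ℝ))) := by
  have h1 : Nat.clog 2 N ≤ Nat.log 2 N + 1 := by
    rw [Nat.clog_le_iff_le_pow one_lt_two]
    exact (Nat.lt_pow_succ_log_self one_lt_two N).le
  have h2 : (Nat.log 2 N : ℝ) ≤ 2 * Real.log (1 + (N : ℝ)) := by
    rcases Nat.eq_zero_or_pos N with rfl | hN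
    · simp
    have hN' : (1 : ℝ) ≤ N := by exact_mod_cast hN
    have hlog : Real.log N ≤ Real.log (1 + (N : ℝ)) := Real.log_le_log (by linarith) (by linarith)
    have h0 := Real.log_nonneg hN'
    have h3 := Real.natLog_le_logb N 2
    have h4 := Real.log_two_gt_d9
    rw [← Real.log_div_log, Nat.cast_ofNat, le_div_iff₀ (by linarith)] at h3
    nlinarith [(Nat.cast_nonneg (Nat.log 2 N) : (0 : ℝ) ≤ _)]
  have h3 : (Nat.clog 2 N : ℝ) ≤ Nat.log 2 N + 1 := by exact_mod_cast h1
  push_cast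
  linarith

end PolynomialValues

theorem stmt_8 (p : ℕ) [Fact p.Prime] (d : ℕ) (hd : 1 ≤ d)
    (R : Fin d → Polynomial (ZMod p))
    (hR : ∀ j, (R j).Monic ∧ Irreducible (R j))
    (hinj : Function.Injective R)
    (r : ℕ) (hr : 1 ≤ r) :
    ∃ K γ : ℝ, 0 < K ∧ 0 < γ ∧
      ∀ D : Finset (Fin d →₀ ℕ), D.Nonempty →
        ({Γ : MvPolynomial (Fin d) (ZMod p) |
            IsMinimalSpecial R Γ ∧ Γ.support ⊆ D ∧ Γ.support.card ≤ r}.ncard : ℝ)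
        ≤ K * (D.card : ℝ) *
            (1 + Real.log (1 + (expDiam D : ℝ))) ^ γ := by
  classical
  obtain ⟨M, k, hM⟩ := exists_card_unitSolutions_le (ι := Fin r)
    (isFrobeniusIndependent_prod_zpow hR hinj) r
  set E : (Fin d → ℤ) → RatFunc (ZMod p) := fun b =>
    ∏ j, algebraMap (Polynomial (ZMod p)) (RatFunc (ZMod p)) (R j) ^ b j with hE
  set Q := Fintype.card (Finset (Fin r) × Fin r × (Fin r → ZMod p)) with hQ
  refine ⟨Q * M * 2 ^ k + 1, k + 1, by positivity, by positivity, fun D _ => ?_⟩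
  set N := expDiam D with hN
  let sol : (Fin d →₀ ℕ) × (Finset (Fin r) × Fin r × (Fin r → ZMod p)) →
      Finset (MvPolynomial (Fin d) (ZMod p)) := fun x =>
    if x.2.2.1 ∈ x.2.1 ∧ ∀ i ∈ x.2.1, x.2.2.2 i ≠ 0 then
      (unitSolutions E x.2.1 x.2.2.1 (fun i =>
        algebraMap (Polynomial (ZMod p)) (RatFunc (ZMod p)) (Polynomial.C (x.2.2.2 i))) N).image
        (translatedPolynomial x.1 x.2.1 x.2.2.2)
    else ∅
  have hsub : {Γ : MvPolynomial (Fin d) (ZMod p) |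
      IsMinimalSpecial R Γ ∧ Γ.support ⊆ D ∧ Γ.support.card ≤ r} ⊆
      ((D ×ˢ Finset.univ).biUnion sol : Finset (MvPolynomial (Fin d) (ZMod p))) := by
    rintro Γ ⟨hΓ, hD, hcard⟩
    obtain ⟨a, ha, s, o, ho, c, hc, b, hb, rfl⟩ :=
      hΓ.exists_eq_translatedPolynomial (fun j => (hR j).1.ne_zero) hD hcard
    refine Finset.mem_coe.2 (Finset.mem_biUnion.2 ⟨(a, s, o, c), by simp [ha], ?_⟩)
    simp only [sol]
    rw [if_pos ⟨ho, hc⟩]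
    exact Finset.mem_image_of_mem _ hb
  have hcount : {Γ : MvPolynomial (Fin d) (ZMod p) |
      IsMinimalSpecial R Γ ∧ Γ.support ⊆ D ∧ Γ.support.card ≤ r}.ncard ≤
      (D.card * Q) * (M * (Nat.clog 2 N + 1) ^ k) := by
    refine (Set.ncard_le_ncard hsub (Finset.finite_toSet _)).trans ?_
    rw [Set.ncard_coe_finset, hQ, ← Finset.card_univ, ← Finset.card_product]
    refine Finset.card_biUnion_le_card_mul _ _ _ fun x _ => ?_
    simp only [sol]
    split_ifs with h
    · refine Finset.card_image_le.trans
        (hM _ ((Finset.card_le_univ _).trans (by simp)) _ h.1 _ (fun i hi => ?_) N)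
      simpa using h.2 i hi
    · simp
  have hlog : (1 : ℝ) ≤ 1 + Real.log (1 + (N : ℝ)) := by
    have : 0 ≤ Real.log (1 + (N : ℝ)) := Real.log_nonneg (by simp)
    linarith
  have hpow : (1 + Real.log (1 + (N : ℝ))) ^ k ≤ (1 + Real.log (1 + (N : ℝ))) ^ ((k : ℝ) + 1) := by
    rw [← Real.rpow_natCast]
    exact Real.rpow_le_rpow_of_exponent_le hlog (by linarith)
  calc _ ≤ (((D.card * Q) * (M * (Nat.clog 2 N + 1) ^ k) : ℕ) : ℝ) := by exact_mod_cast hcount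
    _ = (D.card * Q) * (M * ((Nat.clog 2 N + 1 : ℕ) : ℝ) ^ k) := by push_cast; ring
    _ ≤ (D.card * Q) * (M * (2 * (1 + Real.log (1 + (N : ℝ)))) ^ k) := by
      gcongr
      exact clog_add_one_le_log N
    _ = (Q * M * 2 ^ k) * D.card * (1 + Real.log (1 + (N : ℝ))) ^ k := by rw [mul_pow]; ring
    _ ≤ (Q * M * 2 ^ k + 1) * D.card * (1 + Real.log (1 + (N : ℝ))) ^ ((k : ℝ) + 1) := by
      gcongr
      linarith
end

section
/- Let p be a prime, d ≥ 1, and let R_1, …, R_d ∈ 𝔽_p[x] be pairwise distinct monic irreducible polynomials. Let r ≥ 3 and let Q_1, …, Q_r ∈ 𝔽_p[x] be nonzero polynomials. For A = (a_1, …, a_r) ∈ (ℕ^d)^r and a nonempty subset I ⊆ {1, …, r}, set m_A(I) := 1 if ∑_{j ∈ I} Q_j · ∏_{i=1}^d R_i^{a_{j,i}} = 0 in 𝔽_p[x] and m_A(I) := 0 otherwise, and define the cumulant C(A) := ∑_π (−1)^{|π|−1}·(|π|−1)!·∏_{I ∈ π} m_A(I), where the sum runs over all set partitions π of {1, …, r}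 into nonempty blocks and |π| is the number of blocks. Then there exist constants K > 0 and γ > 0 (depending on p, d, the R_i, the Q_j and r) such that for every finite nonempty set D ⊆ ℕ^d, the number of r-tuples A ∈ D^r with C(A) ≠ 0 is at most K · |D|^{(r−1)/2} · (1 + log(1 + diam D))^γ. -/
open Classical in
/-- `m_A(I) = 1` if `∑_{j ∈ I} Q_j ∏_i R_i^{a_{j,i}} = 0` and `0` otherwise. -/
noncomputable def mA {p d r : ℕ} (R : Fin d → Polynomial (ZMod p))
    (Q : Fin r → Polynomial (ZMod p)) (A : Fin r → Fin d → ℕ) (I : Finset (Fin r)) : ℤ :=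
  if (∑ j ∈ I, Q j * ∏ i, R i ^ A j i) = 0 then 1 else 0

/-- The cumulant `C(A) = ∑_π (−1)^{|π|−1} (|π|−1)! ∏_{I ∈ π} m_A(I)`, summed over all
set partitions `π` of `{1, …, r}` into nonempty blocks. -/
noncomputable def cumulantA {p d r : ℕ} (R : Fin d → Polynomial (ZMod p))
    (Q : Fin r → Polynomial (ZMod p)) (A : Fin r → Fin d → ℕ) : ℤ :=
  ∑ π : Finpartition (Finset.univ : Finset (Fin r)),
    (-1 : ℤ) ^ (π.parts.card - 1) * (Nat.factorial (π.parts.card - 1) : ℤ) *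
      ∏ I ∈ π.parts, mA R Q A I

/-- The diameter of a finite set of vectors in `ℕ^d`. -/
def funDiam {d : ℕ} (D : Finset (Fin d → ℕ)) : ℕ :=
  D.sup fun a => D.sup fun b => Finset.univ.sup fun i : Fin d => ((a i : ℤ) - (b i : ℤ)).natAbs

section Cumulant

open Finset Polynomial

variable {α : Type*} [Fintype α] [DecidableEq α]

open Classical in
/-- The partition of a finite type into the nonempty fibres of a map. -/
noncomputable def fiberPartition {β : Type*} (f : α → β) : Finpartition (univ : Finset α) :=
  Finpartition.ofSetoid (Setoid.ker f)

lemma mem_part_fiberPartition {β : Type*} (f : α → β) {a b : α} :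
    b ∈ (fiberPartition f).part a ↔ f a = f b := by
  classical
  rw [fiberPartition, Finpartition.mem_part_ofSetoid_iff_rel]
  rfl

lemma fiberPartition_eq_iff {β : Type*} (f : α → β) (π : Finpartition (univ : Finset α)) :
    fiberPartition f = π ↔ ∀ a b, f a = f b ↔ b ∈ π.part a := by
  constructor
  · rintro rfl a b
    rw [mem_part_fiberPartition]
  · intro h
    have key : ∀ a, (fiberPartition f).part a = π.part a := by
      intro a
      ext b
      rw [mem_part_fiberPartition, h a b]
    ext I : 2
    constructor
    · intro hI
      obtain ⟨a, ha⟩ := Finpartition.nonempty_of_mem_parts _ hI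
      rw [← Finpartition.part_eq_of_mem _ hI ha, key]
      exact π.part_mem.2 (mem_univ a)
    · intro hI
      obtain ⟨a, ha⟩ := Finpartition.nonempty_of_mem_parts _ hI
      rw [← Finpartition.part_eq_of_mem _ hI ha, ← key]
      exact (Finpartition.part_mem _).2 (mem_univ a)

/-- The number of colourings inducing a given partition is a descending factorial. -/
lemma card_filter_fiberPartition (π : Finpartition (univ : Finset α)) (n : ℕ) :
    #{f : α → Fin n | fiberPartition f = π} = n.descFactorial #π.parts := by
  classical
  have hcard : Fintype.card (π.parts ↪ Fin n) = n.descFactorial #π.parts := by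
    rw [Fintype.card_embedding_eq]; simp
  rw [← hcard, ← Finset.card_univ]
  symm
  refine Finset.card_bij (fun g _ a => g ⟨π.part a, π.part_mem.2 (mem_univ a)⟩) ?_ ?_ ?_
  · intro g _
    simp only [mem_filter, mem_univ, true_and, fiberPartition_eq_iff]
    intro a b
    rw [g.injective.eq_iff, Subtype.mk.injEq,
      Finpartition.mem_part_iff_part_eq_part _ (mem_univ b) (mem_univ a), eq_comm]
  · intro g _ g' _ h
    ext ⟨I, hI⟩ : 1
    obtain ⟨a, ha⟩ := Finpartition.nonempty_of_mem_parts _ hI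
    have := congrFun h a
    simp only [Finpartition.part_eq_of_mem _ hI ha] at this
    rw [this]
  · intro f hf
    simp only [mem_filter, mem_univ, true_and, fiberPartition_eq_iff] at hf
    refine ⟨⟨fun I => f (Finpartition.nonempty_of_mem_parts _ I.2).choose, ?_⟩, mem_univ _, ?_⟩
    · rintro ⟨I, hI⟩ ⟨J, hJ⟩ h
      have h1 := (Finpartition.nonempty_of_mem_parts _ hI).choose_spec
      have h2 := (Finpartition.nonempty_of_mem_parts _ hJ).choose_spec
      have h3 := (hf _ _).1 h
      rw [Finpartition.part_eq_of_mem _ hI h1] at h3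
      exact Subtype.ext (π.eq_of_mem_parts hI hJ h3 h2)
    · funext a
      have h1 := (Finpartition.nonempty_of_mem_parts _
        (π.part_mem.2 (mem_univ a))).choose_spec
      exact ((hf _ _).2 h1).symm

lemma prod_parts_fiberPartition {n : ℕ} (m : Finset α → ℤ) (h0 : m ∅ = 1) (f : α → Fin n) :
    ∏ I ∈ (fiberPartition f).parts, m I = ∏ c, m {a | f a = c} := by
  have hfib : ∀ a, (fiberPartition f).part a = ({b | f b = f a} : Finset α) := by
    intro a
    ext b
    rw [mem_part_fiberPartition]
    simp only [mem_filter, mem_univ, true_and]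
    exact eq_comm
  have hparts : (fiberPartition f).parts =
      (univ.image f).image fun c => ({a | f a = c} : Finset α) := by
    ext I
    simp only [mem_image, mem_univ, true_and, exists_exists_eq_and]
    constructor
    · intro hI
      obtain ⟨a, ha⟩ := Finpartition.nonempty_of_mem_parts _ hI
      exact ⟨a, by rw [← hfib, Finpartition.part_eq_of_mem _ hI ha]⟩
    · rintro ⟨a, rfl⟩
      rw [← hfib]
      exact (Finpartition.part_mem _).2 (mem_univ a)
  rw [hparts, Finset.prod_image]
  · refine Finset.prod_subset (subset_univ _) fun c _ hc => ?_
    have : ({a | f a = c} : Finset α) = ∅ := by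
      ext a
      simp only [mem_image, mem_univ, true_and, not_exists] at hc
      simp [hc a]
    rw [this, h0]
  · intro c hc c' _ h
    simp only [coe_image, coe_univ, Set.image_univ, Set.mem_range] at hc
    obtain ⟨a, rfl⟩ := hc
    have : a ∈ ({b | f b = f a} : Finset α) := by simp
    rw [show ({b | f b = f a} : Finset α) = ({b | f b = c'} : Finset α) from h] at this
    simpa using this

lemma sum_prod_fiber_eq_sum_finpartition (m : Finset α → ℤ) (h0 : m ∅ = 1) (n : ℕ) :
    ∑ f : α → Fin n, ∏ c, m {a | f a = c} =
      ∑ π : Finpartition (univ : Finset α),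
        (n.descFactorial #π.parts : ℤ) * ∏ I ∈ π.parts, m I := by
  classical
  rw [← Finset.sum_fiberwise univ (fun f : α → Fin n => fiberPartition f)]
  refine Finset.sum_congr rfl fun π _ => ?_
  rw [← card_filter_fiberPartition, ← nsmul_eq_mul]
  refine Finset.sum_eq_card_nsmul fun f hf => ?_
  simp only [mem_filter, mem_univ, true_and] at hf
  rw [← hf, prod_parts_fiberPartition m h0]

/-- The polynomial in the number of colours counting colourings weighted by `m` on the
colour classes. -/
noncomputable def colouringPolynomial (m : Finset α → ℤ) : ℤ[X] :=
  ∑ π : Finpartition (univ : Finset α), C (∏ I ∈ π.parts, m I) * descPochhammer ℤ #π.parts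

lemma eval_colouringPolynomial (m : Finset α → ℤ) (h0 : m ∅ = 1) (n : ℕ) :
    (colouringPolynomial m).eval (n : ℤ) = ∑ f : α → Fin n, ∏ c, m {a | f a = c} := by
  rw [sum_prod_fiber_eq_sum_finpartition m h0, colouringPolynomial, eval_finsetSum]
  refine Finset.sum_congr rfl fun π _ => ?_
  rw [eval_mul, eval_C, descPochhammer_eval_eq_descFactorial, mul_comm]

lemma coeff_zero_colouringPolynomial [Nonempty α] (m : Finset α → ℤ) :
    (colouringPolynomial m).coeff 0 = 0 := by
  rw [colouringPolynomial, finsetSum_coeff]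
  refine Finset.sum_eq_zero fun π _ => ?_
  rw [coeff_C_mul, coeff_zero_eq_eval_zero, descPochhammer_ne_zero_eval_zero, mul_zero]
  exact (Finset.card_pos.2 (π.parts_nonempty univ_nonempty.ne_empty)).ne'

lemma coeff_one_descPochhammer (k : ℕ) (hk : k ≠ 0) :
    (descPochhammer ℤ k).coeff 1 = (-1) ^ (k - 1) * ((k - 1).factorial : ℤ) := by
  obtain ⟨k, rfl⟩ := Nat.exists_eq_succ_of_ne_zero hk
  rw [descPochhammer_succ_left]
  refine (coeff_X_mul _ 0).trans ?_
  rw [coeff_zero_eq_eval_zero, eval_comp]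
  simp only [eval_sub, eval_X, eval_one, Nat.succ_sub_one, zero_sub]
  induction k with
  | zero => simp
  | succ k ih =>
    rw [descPochhammer_succ_eval, ih k.succ_ne_zero, Nat.factorial_succ, pow_succ]
    push_cast
    ring

lemma coeff_one_colouringPolynomial [Nonempty α] (m : Finset α → ℤ) :
    (colouringPolynomial m).coeff 1 = ∑ π : Finpartition (univ : Finset α),
      (-1 : ℤ) ^ (#π.parts - 1) * ((#π.parts - 1).factorial : ℤ) * ∏ I ∈ π.parts, m I := by
  rw [colouringPolynomial, finsetSum_coeff]
  refine Finset.sum_congr rfl fun π _ => ?_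
  rw [coeff_C_mul, coeff_one_descPochhammer, mul_comm]
  exact (Finset.card_pos.2 (π.parts_nonempty univ_nonempty.ne_empty)).ne'

/-- The cumulant of a set function that factors over a nontrivial bipartition vanishes. -/
lemma cumulant_eq_zero_of_factors (m : Finset α → ℤ) (h0 : m ∅ = 1) (A : Finset α)
    (hA : A.Nonempty) (hA' : Aᶜ.Nonempty) (h : ∀ I, m I = m (I ∩ A) * m (I \ A)) :
    ∑ π : Finpartition (univ : Finset α),
      (-1 : ℤ) ^ (#π.parts - 1) * ((#π.parts - 1).factorial : ℤ) * ∏ I ∈ π.parts, m I = 0 := by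
  have : Nonempty α := ⟨hA.choose⟩
  have : Nonempty {a // a ∈ A} := ⟨⟨_, hA.choose_spec⟩⟩
  have : Nonempty {a // a ∉ A} := ⟨⟨_, mem_compl.1 hA'.choose_spec⟩⟩
  let m₁ : Finset {a // a ∈ A} → ℤ := fun I => m (I.map (Function.Embedding.subtype _))
  let m₂ : Finset {a // a ∉ A} → ℤ := fun I => m (I.map (Function.Embedding.subtype _))
  have hfactor : colouringPolynomial m = colouringPolynomial m₁ * colouringPolynomial m₂ := by
    refine eq_of_infinite_eval_eq _ _ (Set.infinite_of_injective_forall_mem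
      (f := fun n : ℕ => (n : ℤ)) Nat.cast_injective fun n => ?_)
    simp only [Set.mem_ofPred_eq, eval_mul]
    rw [eval_colouringPolynomial m h0, eval_colouringPolynomial m₁ (by simp [m₁, h0]),
      eval_colouringPolynomial m₂ (by simp [m₂, h0]), Finset.sum_mul_sum, ← Finset.sum_product',
      Finset.univ_product_univ]
    refine Fintype.sum_equiv (Equiv.piEquivPiSubtypeProd (· ∈ A) fun _ => Fin n) _ _ fun f => ?_
    rw [← Finset.prod_mul_distrib]
    refine Finset.prod_congr rfl fun c _ => ?_
    rw [h]
    congr 2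
    · ext a
      simp [and_comm]
    · ext a
      simp [and_comm]
  rw [← coeff_one_colouringPolynomial, hfactor, mul_coeff_one, coeff_zero_colouringPolynomial,
    coeff_zero_colouringPolynomial]
  simp

end Cumulant

section Relation

open Finset
open scoped Pointwise

variable {ι : Type*}

/-- A nonempty vanishing sum without nonempty proper vanishing subsums. -/
def IsMinimalRelation {G : Type*} [AddCommGroup G] (t : ι → G) (I : Finset ι) : Prop :=
  I.Nonempty ∧ ∑ j ∈ I, t j = 0 ∧ ∀ J ⊂ I, J.Nonempty → ∑ j ∈ J, t j ≠ 0

lemma exists_isMinimalRelation_subset {G : Type*} [AddCommGroup G] (t : ι → G) (I : Finset ι)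
    (hI : I.Nonempty) (h : ∑ j ∈ I, t j = 0) : ∃ J ⊆ I, IsMinimalRelation t J := by
  induction I using Finset.strongInduction with
  | H I ih =>
    by_cases hm : ∃ J ⊂ I, J.Nonempty ∧ ∑ j ∈ J, t j = 0
    · obtain ⟨J, hJI, hJ, hJ0⟩ := hm
      obtain ⟨L, hL, hLm⟩ := ih J hJI hJ hJ0
      exact ⟨L, hL.trans hJI.subset, hLm⟩
    · push Not at hm
      exact ⟨I, Subset.rfl, hI, h, hm⟩

variable [DecidableEq ι]

/-- If the part of a vanishing sum indexed by `A` does not vanish, then some minimal relation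
has indices both inside and outside of `A`. -/
lemma exists_isMinimalRelation_straddling {G : Type*} [AddCommGroup G] (t : ι → G)
    (A I : Finset ι) (h : ∑ j ∈ I, t j = 0) (hA : ∑ j ∈ I ∩ A, t j ≠ 0) :
    ∃ J ⊆ I, IsMinimalRelation t J ∧ (∃ j ∈ J, j ∈ A) ∧ ∃ k ∈ J, k ∉ A := by
  induction I using Finset.strongInduction with
  | H I ih =>
    have hI : I.Nonempty := by
      rw [Finset.nonempty_iff_ne_empty]
      rintro rfl
      simp at hA
    obtain ⟨J, hJI, hJ⟩ := exists_isMinimalRelation_subset t I hI h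
    by_cases hJA : (∃ j ∈ J, j ∈ A) ∧ ∃ k ∈ J, k ∉ A
    · exact ⟨J, hJI, hJ, hJA⟩
    · have hJA0 : ∑ j ∈ J ∩ A, t j = 0 := by
        by_cases h1 : ∃ j ∈ J, j ∈ A
        · have : J ∩ A = J := by
            rw [Finset.inter_eq_left]
            intro k hk
            by_contra hkA
            exact hJA ⟨h1, k, hk, hkA⟩
          rw [this, hJ.2.1]
        · have : J ∩ A = ∅ := by
            ext k
            simp only [mem_inter, notMem_empty, iff_false, not_and]
            exact fun hk hkA => h1 ⟨k, hk, hkA⟩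
          rw [this, Finset.sum_empty]
      have hsplit : ∑ j ∈ I \ J, t j = 0 := by
        have := Finset.sum_sdiff (f := t) hJI
        rw [hJ.2.1, h, add_zero] at this
        exact this
      have hsplitA : ∑ j ∈ (I \ J) ∩ A, t j ≠ 0 := by
        have := Finset.sum_sdiff (f := t) (Finset.inter_subset_inter_right hJI (u := A))
        rw [hJA0, add_zero] at this
        rw [← this] at hA
        convert hA using 2
        ext; simp; tauto
      obtain ⟨L, hL, hLm⟩ := ih (I \ J) (Finset.sdiff_ssubset hJI hJ.1) hsplit hsplitA
      exact ⟨L, hL.trans Finset.sdiff_subset, hLm⟩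

/-- If every proper nonempty part of `I` is linked to its complement by a quotient in `Z`, then
all quotients over `I` lie in a power of `Z`. -/
lemma div_mem_pow_of_linked {K : Type*} [Field K] [DecidableEq K] (Z : Finset K) (hZ : 1 ∈ Z)
    (u : ι → K) (I : Finset ι) (hu : ∀ j ∈ I, u j ≠ 0)
    (h : ∀ A ⊂ I, A.Nonempty → ∃ j ∈ A, ∃ k ∈ I \ A, u k / u j ∈ Z)
    {m : ℕ} (hm : #I ≤ m) {j k : ι} (hj : j ∈ I) (hk : k ∈ I) : u j / u k ∈ Z ^ m := by
  have claim : ∀ i, ∃ A ⊆ I, k ∈ A ∧ (A = I ∨ i + 1 ≤ #A) ∧ ∀ j ∈ A, u j / u k ∈ Z ^ i := by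
    intro i
    induction i with
    | zero =>
      refine ⟨{k}, by simpa using hk, by simp, by simp, ?_⟩
      simp [hu k hk]
    | succ i ih =>
      obtain ⟨A, hAI, hkA, hA, hAZ⟩ := ih
      have hmul : ∀ {x y : K}, x ∈ Z ^ i → y ∈ Z → x * y ∈ Z ^ (i + 1) := by
        intro x y hx hy
        rw [pow_succ]
        exact Finset.mul_mem_mul hx hy
      by_cases hAeq : A = I
      · exact ⟨A, hAI, hkA, Or.inl hAeq, fun j hj => by simpa using hmul (hAZ j hj) hZ⟩
      · obtain ⟨j, hj, l, hl, hlj⟩ := h A (hAI.ssubset_of_ne hAeq) ⟨k, hkA⟩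
        rw [Finset.mem_sdiff] at hl
        refine ⟨insert l A, Finset.insert_subset hl.1 hAI, Finset.mem_insert_of_mem hkA,
          Or.inr ?_, ?_⟩
        · rw [Finset.card_insert_of_notMem hl.2]
          have := hA.resolve_left hAeq
          omega
        · intro x hx
          rcases Finset.mem_insert.1 hx with rfl | hx
          · have hj0 := hu j (hAI hj)
            have := hmul (hAZ j hj) hlj
            rwa [div_mul_div_comm, mul_comm, mul_div_mul_right _ _ hj0] at this
          · simpa using hmul (hAZ x hx) hZ
  obtain ⟨A, hAI, -, hA, hAZ⟩ := claim m
  have hAeq : A = I := by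
    rcases hA with hA | hA
    · exact hA
    · have := Finset.card_le_card hAI
      omega
  exact hAZ j (hAeq ▸ hj)

end Relation

section Factorization

open Finset Polynomial UniqueFactorizationMonoid

variable {p : ℕ} [Fact p.Prime]

/-- The multiplicity of `P` among the normalized irreducible factors of `t`. -/
noncomputable def factorCount (P t : (ZMod p)[X]) : ℕ := (normalizedFactors t).count P

lemma factorCount_mul (P : (ZMod p)[X]) {s t : (ZMod p)[X]} (hs : s ≠ 0) (ht : t ≠ 0) :
    factorCount P (s * t) = factorCount P s + factorCount P t := by
  rw [factorCount, normalizedFactors_mul hs ht, Multiset.count_add, factorCount, factorCount]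

lemma factorCount_pow (P t : (ZMod p)[X]) (n : ℕ) :
    factorCount P (t ^ n) = n * factorCount P t := by
  rw [factorCount, normalizedFactors_pow, Multiset.count_nsmul, factorCount]

/-- Nonzero polynomials all of whose normalized irreducible factors lie in `S`. -/
def IsSmoothOver (S : Finset (ZMod p)[X]) (t : (ZMod p)[X]) : Prop :=
  t ≠ 0 ∧ ∀ P ∈ normalizedFactors t, P ∈ S

lemma IsSmoothOver.mul {S : Finset (ZMod p)[X]} {s t : (ZMod p)[X]} (hs : IsSmoothOver S s)
    (ht : IsSmoothOver S t) : IsSmoothOver S (s * t) := by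
  refine ⟨mul_ne_zero hs.1 ht.1, fun P hP => ?_⟩
  rw [normalizedFactors_mul hs.1 ht.1, Multiset.mem_add] at hP
  exact hP.elim (hs.2 P) (ht.2 P)

lemma IsSmoothOver.mono {S T : Finset (ZMod p)[X]} (h : S ⊆ T) {t : (ZMod p)[X]}
    (ht : IsSmoothOver S t) : IsSmoothOver T t :=
  ⟨ht.1, fun P hP => h (ht.2 P hP)⟩

lemma IsSmoothOver.of_dvd {S : Finset (ZMod p)[X]} {s t : (ZMod p)[X]} (hst : s ∣ t)
    (ht : IsSmoothOver S t) : IsSmoothOver S s := by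
  have hs : s ≠ 0 := ne_zero_of_dvd_ne_zero ht.1 hst
  exact ⟨hs, fun P hP => ht.2 P (Multiset.mem_of_le
    ((dvd_iff_normalizedFactors_le_normalizedFactors hs ht.1).1 hst) hP)⟩

lemma finite_setOf_natDegree_le (N : ℕ) : {M : (ZMod p)[X] | M.natDegree ≤ N}.Finite := by
  have : Finite (degreeLT (ZMod p) (N + 1)) :=
    Finite.of_equiv _ (degreeLTEquiv (ZMod p) (N + 1)).toEquiv.symm
  refine (Set.toFinite (degreeLT (ZMod p) (N + 1) : Set (ZMod p)[X])).subset fun M hM => ?_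
  rw [SetLike.mem_coe, mem_degreeLT]
  exact lt_of_le_of_lt (natDegree_le_iff_degree_le.1 hM) (by exact_mod_cast N.lt_succ_self)

lemma dvd_mul_derivative_of_isSmoothOver {S : Finset (ZMod p)[X]} (t : (ZMod p)[X])
    (ht : IsSmoothOver S t) : t ∣ (∏ P ∈ S with P ≠ 0, P) * derivative t := by
  induction t using UniqueFactorizationMonoid.induction_on_prime with
  | h₁ => exact absurd rfl ht.1
  | h₂ x hx => exact hx.dvd
  | h₃ a q ha hq ih =>
    have hqS : normalize q ∈ S := by
      refine ht.2 _ ?_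
      rw [normalizedFactors_mul hq.ne_zero ha, normalizedFactors_irreducible hq.irreducible]
      simp
    have hqd : q ∣ ∏ P ∈ S with P ≠ 0, P :=
      (associated_normalize q).dvd.trans (Finset.dvd_prod_of_mem _ (by simp [hqS, hq.ne_zero]))
    rw [derivative_mul, mul_add]
    refine dvd_add ?_ ?_
    · rw [← mul_assoc]
      exact mul_dvd_mul_right (hqd.mul_right _) a
    · rw [mul_left_comm]
      exact mul_dvd_mul_left q (ih (ht.of_dvd (dvd_mul_left a q)))

/-- Logarithmic derivatives of smooth polynomials take finitely many values. -/
lemma exists_finset_logDeriv (S : Finset (ZMod p)[X]) :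
    ∃ (D : (ZMod p)[X]) (L : Finset (ZMod p)[X]), D ≠ 0 ∧
      ∀ t, IsSmoothOver S t → ∃ M ∈ L, D * derivative t = t * M := by
  set D : (ZMod p)[X] := ∏ P ∈ S with P ≠ 0, P with hD
  have hD0 : D ≠ 0 := Finset.prod_ne_zero_iff.2 fun P hP => (mem_filter.1 hP).2
  refine ⟨D, (finite_setOf_natDegree_le D.natDegree).toFinset, hD0, fun t ht => ?_⟩
  obtain ⟨M, hM⟩ := dvd_mul_derivative_of_isSmoothOver t ht
  rw [← hD] at hM
  refine ⟨M, ?_, hM⟩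
  rw [Set.Finite.mem_toFinset, Set.mem_ofPred_eq]
  by_cases hM0 : M = 0
  · simp [hM0]
  · have h1 := congrArg natDegree hM
    rw [natDegree_mul ht.1 hM0] at h1
    have h2 : (D * derivative t).natDegree ≤ D.natDegree + (derivative t).natDegree :=
      natDegree_mul_le
    have h3 := natDegree_derivative_le t
    omega

lemma not_dvd_derivative_of_irreducible {P : (ZMod p)[X]} (hP : Irreducible P) :
    ¬ P ∣ derivative P := fun h =>
  hP.not_isUnit ((PerfectField.separable_of_irreducible hP).isUnit_of_dvd' dvd_rfl h)

lemma exists_eq_pow_factorCount_mul {P t : (ZMod p)[X]} (hP : Irreducible P)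
    (hPn : normalize P = P) (ht : t ≠ 0) : ∃ u, t = P ^ factorCount P t * u ∧ ¬ P ∣ u := by
  have hfin : FiniteMultiplicity P t := FiniteMultiplicity.of_not_isUnit hP.not_isUnit ht
  have := hfin.exists_eq_pow_mul_and_not_dvd
  rwa [multiplicity_eq_count_normalizedFactors hP ht, hPn] at this

/-- Smooth polynomials with the same logarithmic derivative have factor multiplicities that
agree modulo the characteristic. -/
lemma factorCount_modEq_of_derivative_mul_eq {P s t : (ZMod p)[X]} (hP : Irreducible P)
    (hPn : normalize P = P) (hs : s ≠ 0) (ht : t ≠ 0)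
    (h : derivative s * t = s * derivative t) :
    factorCount P s ≡ factorCount P t [MOD p] := by
  obtain ⟨u, hu, hPu⟩ := exists_eq_pow_factorCount_mul hP hPn hs
  obtain ⟨v, hv, hPv⟩ := exists_eq_pow_factorCount_mul hP hPn ht
  set a := factorCount P s
  set b := factorCount P t
  have hder : ∀ (n : ℕ) (w : (ZMod p)[X]), P * derivative (P ^ n * w) =
      P ^ n * (C (n : ZMod p) * derivative P * w + P * derivative w) := by
    intro n w
    rw [derivative_mul, derivative_pow]
    cases n with
    | zero => simp
    | succ n => rw [Nat.add_sub_cancel]; ring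
  have hP0 : P ≠ 0 := hP.ne_zero
  have h1 : P ^ a * P ^ b * ((C (a : ZMod p) * derivative P * u + P * derivative u) * v) =
      P ^ a * P ^ b * (u * (C (b : ZMod p) * derivative P * v + P * derivative v)) := by
    calc _ = P ^ a * (C (a : ZMod p) * derivative P * u + P * derivative u) * (P ^ b * v) := by
          ring
      _ = P * derivative s * t := by rw [← hder, ← hu, ← hv]
      _ = s * (P * derivative t) := by rw [mul_assoc, h]; ring
      _ = (P ^ a * u) * (P ^ b * (C (b : ZMod p) * derivative P * v + P * derivative v)) := by
          rw [← hder, ← hu, ← hv]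
      _ = _ := by ring
  have h2 := mul_left_cancel₀ (mul_ne_zero (pow_ne_zero a hP0) (pow_ne_zero b hP0)) h1
  have h3 : P ∣ C ((a : ZMod p) - b) * derivative P * (u * v) :=
    ⟨u * derivative v - derivative u * v, by rw [C_sub]; linear_combination h2⟩
  have hprime := hP.prime
  rcases hprime.dvd_or_dvd h3 with h4 | h4
  · rcases hprime.dvd_or_dvd h4 with h5 | h5
    · rw [← ZMod.natCast_eq_natCast_iff]
      by_contra hne
      exact hP.not_isUnit (isUnit_of_dvd_unit h5
        ((isUnit_iff_ne_zero.2 (sub_ne_zero.2 hne)).map C))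
    · exact absurd h5 (not_dvd_derivative_of_irreducible hP)
  · exact absurd h4 (by rw [hprime.dvd_mul]; tauto)

/-- Smooth polynomials whose factor multiplicities agree modulo `p` are `p`-th powers up to
a common factor. -/
lemma exists_eq_mul_pow_of_factorCount_modEq {ι : Type*} {S : Finset (ZMod p)[X]} (I : Finset ι)
    (t : ι → (ZMod p)[X]) (ht : ∀ j ∈ I, IsSmoothOver S (t j))
    (h : ∀ j ∈ I, ∀ k ∈ I, ∀ P, factorCount P (t j) ≡ factorCount P (t k) [MOD p]) :
    ∃ (g : (ZMod p)[X]) (y : ι → (ZMod p)[X]), ∀ j ∈ I, t j = g * y j ^ p := by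
  rcases I.eq_empty_or_nonempty with rfl | ⟨k, hk⟩
  · exact ⟨0, 0, by simp⟩
  · refine ⟨∏ P ∈ S, P ^ (factorCount P (t k) % p), fun j => C (t j).leadingCoeff *
      ∏ P ∈ S, P ^ (factorCount P (t j) / p), fun j hj => ?_⟩
    have h1 : t j = C (t j).leadingCoeff * ∏ P ∈ S, P ^ factorCount P (t j) := by
      conv_lhs => rw [← leadingCoeff_mul_prod_normalizedFactors (t j)]
      rw [Finset.prod_multiset_count_of_subset _ S]
      · rfl
      · intro P hP
        exact (ht j hj).2 P (Multiset.mem_toFinset.1 hP)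
    have h2 : ∏ P ∈ S, P ^ factorCount P (t j) = (∏ P ∈ S, P ^ (factorCount P (t k) % p)) *
        (∏ P ∈ S, P ^ (factorCount P (t j) / p)) ^ p := by
      rw [← Finset.prod_pow, ← Finset.prod_mul_distrib]
      refine Finset.prod_congr rfl fun P _ => ?_
      rw [← pow_mul, ← pow_add, ← h j hj k hk P, mul_comm, Nat.mod_add_div]
    conv_lhs => rw [h1, h2]
    rw [mul_pow, ← C_pow, ZMod.pow_card]
    ring

end Factorization

section UnitEquation

open Finset Polynomial UniqueFactorizationMonoid
open scoped Pointwise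

variable {p : ℕ} [Fact p.Prime] {ι : Type*}

/-- The family `t` is smooth over `S` on `I`, and the factor multiplicities of any two members
differ by less than `p ^ n`. -/
def HasSpread (n : ℕ) (S : Finset (ZMod p)[X]) (I : Finset ι) (t : ι → (ZMod p)[X]) : Prop :=
  (∀ j ∈ I, IsSmoothOver S (t j)) ∧
    ∀ j ∈ I, ∀ k ∈ I, ∀ P, factorCount P (t j) < factorCount P (t k) + p ^ n

lemma HasSpread.subset {n : ℕ} {S : Finset (ZMod p)[X]} {I J : Finset ι}
    {t : ι → (ZMod p)[X]} (h : HasSpread n S I t) (hJ : J ⊆ I) : HasSpread n S J t :=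
  ⟨fun j hj => h.1 j (hJ hj), fun j hj k hk => h.2 j (hJ hj) k (hJ hk)⟩

lemma HasSpread.mul {n c : ℕ} {S T : Finset (ZMod p)[X]} {I : Finset ι}
    {t δ : ι → (ZMod p)[X]} (h : HasSpread n S I t) (hST : S ⊆ T)
    (hδ : ∀ j ∈ I, IsSmoothOver T (δ j)) (hc : ∀ j ∈ I, ∀ P, factorCount P (δ j) ≤ c) :
    HasSpread (n + c) T I fun j => δ j * t j := by
  refine ⟨fun j hj => (hδ j hj).mul ((h.1 j hj).mono hST), fun j hj k hk P => ?_⟩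
  rw [factorCount_mul P (hδ j hj).1 (h.1 j hj).1, factorCount_mul P (hδ k hk).1 (h.1 k hk).1]
  have h1 := h.2 j hj k hk P
  have h2 := hc j hj P
  have hp : 1 < p := (Fact.out : p.Prime).one_lt
  have h3 : c < p ^ c := Nat.lt_pow_self hp
  have h4 : 0 < p ^ n := pow_pos (by omega) n
  have h5 : p ^ n * (c + 1) ≤ p ^ n * p ^ c := Nat.mul_le_mul_left _ h3
  have h6 : c ≤ p ^ n * c := Nat.le_mul_of_pos_left c h4
  rw [pow_add]
  rw [mul_add, mul_one] at h5
  omega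

/-- Nondegenerate `S`-unit equations in at most `s` unknowns, with exponents spread over a
range of length `p ^ n`, have polynomially many (in `n`) solutions up to scaling. -/
def FewUnitSolutions (p : ℕ) [Fact p.Prime] (ι : Type*) (s : ℕ) : Prop :=
  ∀ S : Finset (ZMod p)[X], ∃ B g : ℕ, ∀ n : ℕ, ∃ Y : Finset (FractionRing (ZMod p)[X]),
    #Y ≤ B * (n + 1) ^ g ∧ ∀ (I : Finset ι) (t : ι → (ZMod p)[X]), #I ≤ s → HasSpread n S I t →
      IsMinimalRelation t I → ∀ j ∈ I, ∀ k ∈ I,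
        algebraMap _ (FractionRing (ZMod p)[X]) (t j) / algebraMap _ _ (t k) ∈ Y

/-- Solutions whose terms do not all have the same logarithmic derivative satisfy further
relations with fewer terms. -/
lemma FewUnitSolutions.succ_of_derivative_ne [DecidableEq ι] {s : ℕ}
    (hs : FewUnitSolutions p ι s) (S : Finset (ZMod p)[X]) :
    ∃ B g : ℕ, ∀ n : ℕ, ∃ Z : Finset (FractionRing (ZMod p)[X]),
      #Z ≤ B * (n + 1) ^ g ∧ ∀ (I : Finset ι) (t : ι → (ZMod p)[X]), #I ≤ s + 1 →
        HasSpread n S I t → IsMinimalRelation t I →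
        (∃ j ∈ I, ∃ k ∈ I, derivative (t j) * t k ≠ t j * derivative (t k)) →
        ∀ j ∈ I, ∀ k ∈ I,
          algebraMap _ (FractionRing (ZMod p)[X]) (t j) / algebraMap _ _ (t k) ∈ Z := by
  classical
  obtain ⟨D, L, hD, hL⟩ := exists_finset_logDeriv S
  set Δ : Finset (ZMod p)[X] := {δ ∈ image₂ (fun a b => a - b) L L | δ ≠ 0} with hΔ
  set T := S ∪ Δ.biUnion fun δ => (normalizedFactors δ).toFinset with hT
  set c := ∑ δ ∈ Δ, (normalizedFactors δ).card with hc
  have hΔT : ∀ δ ∈ Δ, IsSmoothOver T δ := fun δ hδ =>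
    ⟨(mem_filter.1 hδ).2, fun P hP => mem_union_right _
      (mem_biUnion.2 ⟨δ, hδ, Multiset.mem_toFinset.2 hP⟩)⟩
  have hΔc : ∀ δ ∈ Δ, ∀ P, factorCount P δ ≤ c := fun δ hδ P =>
    (Multiset.count_le_card _ _).trans
      (Finset.single_le_sum (f := fun δ => (normalizedFactors δ).card) (fun _ _ => Nat.zero_le _) hδ)
  obtain ⟨B, g, hBg⟩ := hs T
  refine ⟨(1 + B * (c + 1) ^ g * #Δ * #Δ) ^ (s + 1), g * (s + 1), fun n => ?_⟩
  obtain ⟨Y, hYcard, hY⟩ := hBg (n + c)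
  set φ := algebraMap (ZMod p)[X] (FractionRing (ZMod p)[X]) with hφ
  have hφ0 : ∀ {x}, x ≠ 0 → φ x ≠ 0 := fun {x} hx => by
    rwa [Ne, hφ, IsFractionRing.to_map_eq_zero_iff]
  set Z : Finset (FractionRing (ZMod p)[X]) :=
    insert 1 ((Y ×ˢ Δ ×ˢ Δ).image fun x => x.1 * (φ x.2.1 / φ x.2.2)) with hZ
  have hZcard : #Z ≤ (1 + B * (c + 1) ^ g * #Δ * #Δ) * (n + 1) ^ g := by
    calc #Z ≤ #Y * (#Δ * #Δ) + 1 := by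
          refine (card_insert_le _ _).trans (Nat.add_le_add_right (card_image_le.trans ?_) 1)
          rw [card_product, card_product]
      _ ≤ (B * ((c + 1) * (n + 1)) ^ g) * (#Δ * #Δ) + 1 * (n + 1) ^ g := by
          gcongr
          · refine hYcard.trans ?_
            gcongr
            nlinarith
          · rw [one_mul]; exact Nat.one_le_pow _ _ n.succ_pos
      _ = _ := by rw [mul_pow]; ring
  refine ⟨Z ^ (s + 1), ?_, ?_⟩
  · calc #(Z ^ (s + 1)) ≤ #Z ^ (s + 1) := card_pow_le
      _ ≤ ((1 + B * (c + 1) ^ g * #Δ * #Δ) * (n + 1) ^ g) ^ (s + 1) := by gcongr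
      _ = _ := by rw [mul_pow, ← pow_mul]
  · intro I t hI hsp hmin ⟨a, ha, b, hb, hab⟩ j hj k hk
    choose! M hML hMt using hL
    have hM : ∀ j ∈ I, D * derivative (t j) = t j * M (t j) := fun j hj => hMt _ (hsp.1 j hj)
    have hMab : M (t a) ≠ M (t b) := by
      intro h
      refine hab (mul_left_cancel₀ hD ?_)
      rw [← mul_assoc, hM a ha, mul_left_comm, hM b hb, h]
      ring
    refine div_mem_pow_of_linked Z (mem_insert_self _ _) (fun j => φ (t j)) I
      (fun j hj => hφ0 (hsp.1 j hj).1) ?_ hI hj hk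
    intro A hAI hA
    have hAsum := hmin.2.2 A hAI hA
    obtain ⟨e, he, hesum⟩ : ∃ e ∈ I, ∑ j ∈ A, (M (t j) - M (t e)) * t j ≠ 0 := by
      by_contra! h
      have h1 := h a ha
      have h2 := h b hb
      have : (M (t a) - M (t b)) * ∑ j ∈ A, t j = 0 := by
        rw [← sub_eq_zero.2 (h2.trans h1.symm), ← Finset.sum_sub_distrib, Finset.mul_sum]
        exact Finset.sum_congr rfl fun j _ => by ring
      exact (mul_ne_zero (sub_ne_zero.2 hMab) hAsum) this
    set δ : ι → (ZMod p)[X] := fun j => M (t j) - M (t e) with hδ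
    set I' := {j ∈ I | δ j ≠ 0} with hI'
    have hI'I : I' ⊆ I := filter_subset _ _
    have hδΔ : ∀ j ∈ I', δ j ∈ Δ := fun j hj => by
      rw [mem_filter] at hj
      exact mem_filter.2 ⟨mem_image₂_of_mem (hML _ (hsp.1 j hj.1)) (hML _ (hsp.1 e he)), hj.2⟩
    have hsum : ∑ j ∈ I', δ j * t j = 0 := by
      have h0 : ∑ j ∈ I', δ j * t j = ∑ j ∈ I, δ j * t j := by
        refine Finset.sum_subset hI'I fun j hj hj' => ?_
        have : δ j = 0 := by
          by_contra h
          exact hj' (mem_filter.2 ⟨hj, h⟩)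
        rw [this, zero_mul]
      rw [h0]
      calc ∑ j ∈ I, δ j * t j = ∑ j ∈ I, (D * derivative (t j) - M (t e) * t j) :=
            Finset.sum_congr rfl fun j hj => by rw [hM j hj]; ring
        _ = D * derivative (∑ j ∈ I, t j) - M (t e) * ∑ j ∈ I, t j := by
            rw [Finset.sum_sub_distrib, ← Finset.mul_sum, ← Finset.mul_sum, derivative_sum]
        _ = 0 := by rw [hmin.2.1]; simp
    have hsumA : ∑ j ∈ I' ∩ A, δ j * t j ≠ 0 := by
      have : ∑ j ∈ I' ∩ A, δ j * t j = ∑ j ∈ A, δ j * t j := by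
        refine Finset.sum_subset inter_subset_right fun j hj hj' => ?_
        have : δ j = 0 := by
          by_contra h
          exact hj' (mem_inter.2 ⟨mem_filter.2 ⟨hAI.subset hj, h⟩, hj⟩)
        rw [this, zero_mul]
      rw [this]
      exact hesum
    obtain ⟨J, hJI', hJ, ⟨x, hxJ, hxA⟩, y, hyJ, hyA⟩ :=
      exists_isMinimalRelation_straddling (fun j => δ j * t j) A I' hsum hsumA
    have hJcard : #J ≤ s := by
      have : e ∉ I' := fun h => (mem_filter.1 h).2 (sub_self _)
      have h1 : #I' < #I := card_lt_card
        (hI'I.ssubset_of_ne fun h => this (h ▸ he))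
      have := card_le_card hJI'
      omega
    have hJΔ : ∀ j ∈ J, δ j ∈ Δ := fun j hj => hδΔ j (hJI' hj)
    have hYmem := hY J (fun j => δ j * t j) hJcard
      ((hsp.subset (hJI'.trans hI'I)).mul subset_union_left (fun j hj => hΔT _ (hJΔ j hj))
        fun j hj => hΔc _ (hJΔ j hj)) hJ y hyJ x hxJ
    refine ⟨x, hxA, y, mem_sdiff.2 ⟨hI'I (hJI' hyJ), hyA⟩, mem_insert_of_mem
      (mem_image.2 ⟨(_, δ x, δ y), mem_product.2 ⟨hYmem, mem_product.2 ⟨hJΔ x hxJ, hJΔ y hyJ⟩⟩, ?_⟩)⟩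
    have hx0 := hφ0 (mem_filter.1 (hJΔ x hxJ)).2
    have hy0 := hφ0 (mem_filter.1 (hJΔ y hyJ)).2
    have htx := hφ0 (hsp.1 x (hI'I (hJI' hxJ))).1
    simp only [map_mul]
    field_simp

lemma fewUnitSolutions_succ [DecidableEq ι] {s : ℕ} (hs : FewUnitSolutions p ι s) :
    FewUnitSolutions p ι (s + 1) := by
  classical
  intro S
  have hp : p.Prime := Fact.out
  obtain ⟨B, g, hBg⟩ := hs.succ_of_derivative_ne S
  refine ⟨B + p, g + 1, fun n => ?_⟩
  set φ := algebraMap (ZMod p)[X] (FractionRing (ZMod p)[X]) with hφ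
  have hφ0 : ∀ {x}, x ≠ 0 → φ x ≠ 0 := fun {x} hx => by
    rwa [Ne, hφ, IsFractionRing.to_map_eq_zero_iff]
  induction n with
  | zero =>
    refine ⟨univ.image fun c : ZMod p => φ (C c), ?_, ?_⟩
    · refine card_image_le.trans ?_
      rw [card_univ, ZMod.card]
      simp
    · intro I t _ hsp _ j hj k hk
      have hcount : normalizedFactors (t j) = normalizedFactors (t k) := by
        ext P
        have h1 := hsp.2 j hj k hk P
        have h2 := hsp.2 k hk j hj P
        rw [pow_zero] at h1 h2
        exact le_antisymm (Nat.lt_succ_iff.1 h1) (Nat.lt_succ_iff.1 h2)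
      obtain ⟨u, hu⟩ := (associated_iff_normalizedFactors_eq_normalizedFactors
        (hsp.1 k hk).1 (hsp.1 j hj).1).2 hcount.symm
      obtain ⟨c, -, hc⟩ := Polynomial.isUnit_iff.1 u.isUnit
      refine mem_image.2 ⟨c, mem_univ _, ?_⟩
      rw [← hu, ← hc, map_mul, mul_div_cancel_left₀ _ (hφ0 (hsp.1 k hk).1)]
  | succ n ih =>
    obtain ⟨Y, hYcard, hY⟩ := ih
    obtain ⟨Z, hZcard, hZ⟩ := hBg (n + 1)
    refine ⟨Z ∪ Y.image (· ^ p), ?_, ?_⟩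
    · calc #(Z ∪ Y.image (· ^ p)) ≤ #Z + #Y := (card_union_le _ _).trans
            (Nat.add_le_add_left card_image_le _)
        _ ≤ (B + p) * (n + 1 + 1) ^ g + (B + p) * ((n + 1 + 1) ^ g * (n + 1)) := by
            refine add_le_add (hZcard.trans ?_) (hYcard.trans ?_)
            · gcongr; omega
            · rw [pow_succ]; gcongr; omega
        _ = _ := by ring
    · intro I t hI hsp hmin j hj k hk
      by_cases hder : ∃ j ∈ I, ∃ k ∈ I, derivative (t j) * t k ≠ t j * derivative (t k)
      · exact mem_union_left _ (hZ I t hI hsp hmin hder j hj k hk)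
      push Not at hder
      have hmod : ∀ j ∈ I, ∀ k ∈ I, ∀ P, factorCount P (t j) ≡ factorCount P (t k) [MOD p] := by
        intro j hj k hk P
        by_cases hP : ∃ l ∈ I, P ∈ normalizedFactors (t l)
        · obtain ⟨l, -, hPl⟩ := hP
          exact factorCount_modEq_of_derivative_mul_eq (irreducible_of_normalized_factor P hPl)
            (normalize_normalized_factor P hPl) (hsp.1 j hj).1 (hsp.1 k hk).1 (hder j hj k hk)
        · push Not at hP
          rw [factorCount, factorCount, Multiset.count_eq_zero_of_notMem (hP j hj),
            Multiset.count_eq_zero_of_notMem (hP k hk)]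
      obtain ⟨w, y, hwy⟩ := exists_eq_mul_pow_of_factorCount_modEq I t hsp.1 hmod
      have hw0 : w ≠ 0 := by
        rintro rfl
        exact (hsp.1 j hj).1 (by rw [hwy j hj, zero_mul])
      have hy0 : ∀ i ∈ I, y i ≠ 0 := by
        intro i hi h
        exact (hsp.1 i hi).1 (by rw [hwy i hi, h, zero_pow hp.ne_zero, mul_zero])
      have hsum : ∀ J ⊆ I, ∑ i ∈ J, t i = w * (∑ i ∈ J, y i) ^ p := by
        intro J hJ
        rw [sum_pow_char, Finset.mul_sum]
        exact Finset.sum_congr rfl fun i hi => hwy i (hJ hi)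
      have hyS : HasSpread n S I y := by
        refine ⟨fun i hi => (hsp.1 i hi).of_dvd ?_, fun i hi l hl P => ?_⟩
        · rw [hwy i hi]
          exact (dvd_pow_self _ hp.ne_zero).mul_left _
        · have h1 := hsp.2 i hi l hl P
          rw [hwy i hi, hwy l hl, factorCount_mul P hw0 (pow_ne_zero _ (hy0 i hi)),
            factorCount_mul P hw0 (pow_ne_zero _ (hy0 l hl)), factorCount_pow, factorCount_pow,
            add_assoc, Nat.add_lt_add_iff_left, pow_succ', ← mul_add] at h1
          exact Nat.lt_of_mul_lt_mul_left h1
      have hymin : IsMinimalRelation y I := by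
        refine ⟨hmin.1, ?_, fun J hJ hJne h => hmin.2.2 J hJ hJne ?_⟩
        · have := hsum I Subset.rfl
          rw [hmin.2.1] at this
          exact eq_zero_of_pow_eq_zero ((mul_eq_zero.1 this.symm).resolve_left hw0)
        · rw [hsum J hJ.subset, h, zero_pow hp.ne_zero, mul_zero]
      refine mem_union_right _ (mem_image.2 ⟨_, hY I y hI hyS hymin j hj k hk, ?_⟩)
      have := hφ0 hw0
      rw [hwy j hj, hwy k hk, map_mul, map_mul, map_pow, map_pow, div_pow,
        mul_div_mul_left _ _ this]

/-- The `S`-unit theorem over `𝔽_p(x)` for exponents in a bounded range. -/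
theorem fewUnitSolutions (p : ℕ) [Fact p.Prime] (ι : Type*) [DecidableEq ι] (s : ℕ) :
    FewUnitSolutions p ι s := by
  induction s with
  | zero =>
    refine fun S => ⟨0, 0, fun n => ⟨∅, by simp, fun I t hI _ _ j hj => ?_⟩⟩
    rw [Finset.card_eq_zero.1 (Nat.le_zero.1 hI)] at hj
    simp at hj
  | succ s ih => exact fewUnitSolutions_succ ih

end UnitEquation

section Counting

open Finset Polynomial UniqueFactorizationMonoid
open scoped Pointwise

variable {p : ℕ} [Fact p.Prime]

lemma normalizedFactors_of_monic_irreducible {P : (ZMod p)[X]} (hm : P.Monic)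
    (hP : Irreducible P) : normalizedFactors P = {P} := by
  rw [normalizedFactors_irreducible hP, hm.normalize_eq_self]

lemma factorCount_prod_pow {d : ℕ} {R : Fin d → (ZMod p)[X]}
    (hR : ∀ i, (R i).Monic ∧ Irreducible (R i)) (P : (ZMod p)[X]) (a : Fin d → ℕ) :
    factorCount P (∏ i, R i ^ a i) = ∑ i, if P = R i then a i else 0 := by
  classical
  have h : ∀ s : Finset (Fin d), factorCount P (∏ i ∈ s, R i ^ a i) =
      ∑ i ∈ s, if P = R i then a i else 0 := by
    intro s
    induction s using Finset.induction_on with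
    | empty => simp [factorCount]
    | insert i s hi ih =>
      rw [Finset.prod_insert hi, Finset.sum_insert hi, factorCount_mul P
        (pow_ne_zero _ (hR i).2.ne_zero)
        (Finset.prod_ne_zero_iff.2 fun j _ => pow_ne_zero _ (hR j).2.ne_zero), ih,
        factorCount_pow, factorCount, normalizedFactors_of_monic_irreducible (hR i).1 (hR i).2,
        Multiset.count_singleton]
      simp
  exact h univ

lemma factorCount_prod_pow_self {d : ℕ} {R : Fin d → (ZMod p)[X]}
    (hR : ∀ i, (R i).Monic ∧ Irreducible (R i)) (hinj : Function.Injective R) (a : Fin d → ℕ)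
    (i : Fin d) : factorCount (R i) (∏ i, R i ^ a i) = a i := by
  rw [factorCount_prod_pow hR]
  simp [hinj.eq_iff]

lemma prod_pow_injective {d : ℕ} {R : Fin d → (ZMod p)[X]}
    (hR : ∀ i, (R i).Monic ∧ Irreducible (R i)) (hinj : Function.Injective R) :
    Function.Injective fun a : Fin d → ℕ => ∏ i, R i ^ a i := by
  intro a b h
  funext i
  rw [← factorCount_prod_pow_self hR hinj a i, ← factorCount_prod_pow_self hR hinj b i]
  exact congrArg _ h

lemma le_add_funDiam {d : ℕ} {D : Finset (Fin d → ℕ)} {a b : Fin d → ℕ} (ha : a ∈ D)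
    (hb : b ∈ D) (i : Fin d) : a i ≤ b i + funDiam D := by
  have h := le_refl (funDiam D)
  nth_rw 1 [funDiam] at h
  simp only [Finset.sup_le_iff] at h
  have h1 := h a ha b hb i (mem_univ i)
  omega

/-- If the cumulant is nonzero, then minimal relations link every proper part of the index set
to its complement. -/
lemma exists_straddling_of_cumulantA_ne_zero {d r : ℕ} {R : Fin d → (ZMod p)[X]}
    {Q : Fin r → (ZMod p)[X]} {A : Fin r → Fin d → ℕ} (h : cumulantA R Q A ≠ 0)
    (S : Finset (Fin r)) (hS : S.Nonempty) (hS' : Sᶜ.Nonempty) :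
    ∃ J, IsMinimalRelation (fun j => Q j * ∏ i, R i ^ A j i) J ∧
      (∃ j ∈ J, j ∈ S) ∧ ∃ k ∈ J, k ∉ S := by
  by_contra hcon
  refine h (cumulant_eq_zero_of_factors (mA R Q A) (by simp [mA]) S hS hS' fun I => ?_)
  have hsplit := Finset.sum_inter_add_sum_sdiff I S fun j => Q j * ∏ i, R i ^ A j i
  by_cases hI : ∑ j ∈ I, Q j * ∏ i, R i ^ A j i = 0
  · have hIS : ∑ j ∈ I ∩ S, Q j * ∏ i, R i ^ A j i = 0 := by
      by_contra hne
      obtain ⟨J, -, hJ⟩ := exists_isMinimalRelation_straddling _ S I hI hne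
      exact hcon ⟨J, hJ⟩
    rw [hIS, hI, zero_add] at hsplit
    simp [mA, hI, hIS, hsplit]
  · by_cases hIS : ∑ j ∈ I ∩ S, Q j * ∏ i, R i ^ A j i = 0
    · rw [hIS, zero_add] at hsplit
      simp [mA, hI, hsplit]
    · simp [mA, hI, hIS]

lemma hasSpread_of_mem {d r n c : ℕ} {R : Fin d → (ZMod p)[X]}
    (hR : ∀ i, (R i).Monic ∧ Irreducible (R i)) (hinj : Function.Injective R)
    {Q : Fin r → (ZMod p)[X]} (hQ : ∀ j, Q j ≠ 0) (hc : ∀ j P, factorCount P (Q j) ≤ c)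
    {D : Finset (Fin d → ℕ)} (hn : funDiam D + c < p ^ n) {A : Fin r → Fin d → ℕ}
    (hA : ∀ j, A j ∈ D) (I : Finset (Fin r)) :
    HasSpread n (univ.image R ∪ univ.biUnion fun j => (normalizedFactors (Q j)).toFinset) I
      fun j => Q j * ∏ i, R i ^ A j i := by
  have hprod : ∀ a : Fin d → ℕ, ∏ i, R i ^ a i ≠ 0 := fun a =>
    Finset.prod_ne_zero_iff.2 fun i _ => pow_ne_zero _ (hR i).2.ne_zero
  refine ⟨fun j _ => ⟨mul_ne_zero (hQ j) (hprod _), fun P hP => ?_⟩, fun j _ k _ P => ?_⟩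
  · rw [normalizedFactors_mul (hQ j) (hprod _), Multiset.mem_add] at hP
    rcases hP with hP | hP
    · exact mem_union_right _ (mem_biUnion.2 ⟨j, mem_univ j, Multiset.mem_toFinset.2 hP⟩)
    · refine mem_union_left _ ?_
      have h1 : factorCount P (∏ i, R i ^ A j i) ≠ 0 := Multiset.count_ne_zero.2 hP
      rw [factorCount_prod_pow hR] at h1
      obtain ⟨i, -, hi⟩ := Finset.exists_ne_zero_of_sum_ne_zero h1
      refine mem_image.2 ⟨i, mem_univ i, ?_⟩
      by_contra hne
      exact hi (if_neg fun h => hne h.symm)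
  · rw [factorCount_mul P (hQ j) (hprod _), factorCount_mul P (hQ k) (hprod _)]
    have h1 := hc j P
    have h2 : factorCount P (∏ i, R i ^ A j i) ≤
        factorCount P (∏ i, R i ^ A k i) + funDiam D := by
      by_cases hP : ∃ i, R i = P
      · obtain ⟨i, rfl⟩ := hP
        rw [factorCount_prod_pow_self hR hinj, factorCount_prod_pow_self hR hinj]
        exact le_add_funDiam (hA j) (hA k) i
      · have : ∀ a : Fin d → ℕ, factorCount P (∏ i, R i ^ a i) = 0 := fun a => by
          rw [factorCount_prod_pow hR]
          exact Finset.sum_eq_zero fun i _ => if_neg fun h => hP ⟨i, h.symm⟩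
        rw [this, this]
        exact Nat.zero_le _
    omega

/-- The number of tuples with nonzero cumulant is at most `|D|` up to a factor that is polynomial
in any `n` with `diam D + c < p ^ n`. -/
lemma exists_ncard_cumulantA_ne_zero_le {d r : ℕ} (hr : 0 < r) {R : Fin d → (ZMod p)[X]}
    (hR : ∀ i, (R i).Monic ∧ Irreducible (R i)) (hinj : Function.Injective R)
    {Q : Fin r → (ZMod p)[X]} (hQ : ∀ j, Q j ≠ 0) :
    ∃ B g c : ℕ, ∀ (D : Finset (Fin d → ℕ)) (n : ℕ), funDiam D + c < p ^ n →
      {A : Fin r → Fin d → ℕ | (∀ j, A j ∈ D) ∧ cumulantA R Q A ≠ 0}.ncard ≤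
        #D * (B * (n + 1) ^ g) := by
  classical
  set S := univ.image R ∪ univ.biUnion fun j => (normalizedFactors (Q j)).toFinset with hS
  obtain ⟨B, g, hBg⟩ := fewUnitSolutions p (Fin r) r S
  refine ⟨((B + 1) ^ r) ^ r, g * r * r, ∑ j, (normalizedFactors (Q j)).card, fun D n hn => ?_⟩
  have hc : ∀ j P, factorCount P (Q j) ≤ ∑ j, (normalizedFactors (Q j)).card := fun j P =>
    (Multiset.count_le_card _ _).trans (Finset.single_le_sum
      (f := fun j => (normalizedFactors (Q j)).card) (fun _ _ => Nat.zero_le _) (mem_univ j))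
  obtain ⟨Y, hYcard, hY⟩ := hBg n
  set φ := algebraMap (ZMod p)[X] (FractionRing (ZMod p)[X]) with hφ
  have hφ0 : ∀ {x}, x ≠ 0 → φ x ≠ 0 := fun {x} hx => by
    rwa [Ne, hφ, IsFractionRing.to_map_eq_zero_iff]
  have hprod : ∀ a : Fin d → ℕ, ∏ i, R i ^ a i ≠ 0 := fun a =>
    Finset.prod_ne_zero_iff.2 fun i _ => pow_ne_zero _ (hR i).2.ne_zero
  set t : (Fin r → Fin d → ℕ) → Fin r → (ZMod p)[X] :=
    fun A j => Q j * ∏ i, R i ^ A j i with ht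
  have ht0 : ∀ A j, t A j ≠ 0 := fun A j => mul_ne_zero (hQ j) (hprod _)
  set W := (insert 1 Y) ^ r with hW
  have hWcard : #W ≤ (B + 1) ^ r * (n + 1) ^ (g * r) := by
    calc #W ≤ #(insert 1 Y) ^ r := card_pow_le
      _ ≤ ((B + 1) * (n + 1) ^ g) ^ r := by
          gcongr
          refine (card_insert_le _ _).trans ?_
          have : 1 ≤ (n + 1) ^ g := Nat.one_le_pow _ _ n.succ_pos
          rw [add_mul, one_mul]
          omega
      _ = _ := by rw [mul_pow, ← pow_mul]
  let j₀ : Fin r := ⟨0, hr⟩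
  have hmem : ∀ A : Fin r → Fin d → ℕ, (∀ j, A j ∈ D) → cumulantA R Q A ≠ 0 →
      ∀ j, φ (t A j) / φ (t A j₀) ∈ W := by
    intro A hA hcum j
    refine div_mem_pow_of_linked (insert 1 Y) (mem_insert_self _ _) (fun j => φ (t A j)) univ
      (fun j _ => hφ0 (ht0 A j)) ?_ (by simp) (mem_univ _) (mem_univ _)
    intro T hT hTne
    have hTc : Tᶜ.Nonempty := by
      rw [Finset.nonempty_iff_ne_empty, Ne, Finset.compl_eq_empty_iff]
      exact hT.ne
    obtain ⟨J, hJ, ⟨x, hxJ, hxT⟩, y, hyJ, hyT⟩ :=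
      exists_straddling_of_cumulantA_ne_zero hcum T hTne hTc
    refine ⟨x, hxT, y, mem_sdiff.2 ⟨mem_univ _, hyT⟩, mem_insert_of_mem ?_⟩
    exact hY J (t A) ((card_le_univ J).trans (by simp))
      (hasSpread_of_mem hR hinj hQ hc hn hA J) hJ y hyJ x hxJ
  have hle := Set.ncard_le_ncard_of_injOn
    (s := {A : Fin r → Fin d → ℕ | (∀ j, A j ∈ D) ∧ cumulantA R Q A ≠ 0})
    (t := ((D ×ˢ Fintype.piFinset fun _ : Fin r => W :
      Finset ((Fin d → ℕ) × (Fin r → FractionRing (ZMod p)[X]))) : Set _))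
    (fun A => (A j₀, fun j => φ (t A j) / φ (t A j₀)))
    (fun A hA => by
      rw [mem_coe, mem_product, Fintype.mem_piFinset]
      exact ⟨hA.1 j₀, hmem A hA.1 hA.2⟩)
    (fun A _ A' _ h => by
      rw [Prod.mk.injEq] at h
      have h0 : t A j₀ = t A' j₀ := by simp only [ht, h.1]
      funext j
      have h1 := congrFun h.2 j
      simp only [h0] at h1
      rw [div_left_inj' (hφ0 (ht0 A' j₀))] at h1
      exact prod_pow_injective hR hinj
        (mul_left_cancel₀ (hQ j) (IsFractionRing.injective _ (FractionRing (ZMod p)[X]) h1)))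
    (Finset.finite_toSet _)
  refine hle.trans ?_
  rw [Set.ncard_coe_finset, card_product, Fintype.card_piFinset, Finset.prod_const, card_univ,
    Fintype.card_fin]
  gcongr
  calc #W ^ r ≤ ((B + 1) ^ r * (n + 1) ^ (g * r)) ^ r := by gcongr
    _ = _ := by rw [mul_pow, ← pow_mul _ (g * r)]

end Counting

lemma exists_lt_pow_and_le_log {p : ℕ} (hp : 2 ≤ p) (δ c : ℕ) :
    ∃ n : ℕ, δ + c < p ^ n ∧ ((n : ℝ) + 1) ≤ (c + 2) * (1 + Real.log (1 + δ)) := by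
  refine ⟨Nat.log p (δ + 1) + 1 + c, ?_, ?_⟩
  · have h1 : δ + 1 < p ^ (Nat.log p (δ + 1) + 1) := Nat.lt_pow_succ_log_self hp _
    have h2 : c < p ^ c := Nat.lt_pow_self hp
    rw [pow_add]
    nlinarith
  · have h1 : p ^ Nat.log p (δ + 1) ≤ δ + 1 := Nat.pow_log_le_self p δ.succ_ne_zero
    have h2 : (2 : ℝ) ^ Nat.log p (δ + 1) ≤ 1 + δ := by
      calc (2 : ℝ) ^ Nat.log p (δ + 1) ≤ (p : ℝ) ^ Nat.log p (δ + 1) := by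
            gcongr; exact_mod_cast hp
        _ ≤ 1 + δ := by rw [add_comm (1 : ℝ)]; exact_mod_cast h1
    have h3 := Real.log_le_log (by positivity) h2
    rw [Real.log_pow] at h3
    have h4 := Real.log_two_gt_d9
    have h5 : (0 : ℝ) ≤ Nat.log p (δ + 1) := Nat.cast_nonneg _
    have h6 : (0 : ℝ) ≤ c := Nat.cast_nonneg _
    have h7 : 0 ≤ Real.log (1 + δ) := Real.log_nonneg (by simp)
    push_cast
    nlinarith [mul_nonneg h6 h7]

theorem stmt_12 (p : ℕ) [Fact p.Prime] (d : ℕ) (hd : 1 ≤ d)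
    (R : Fin d → Polynomial (ZMod p))
    (hR : ∀ j, (R j).Monic ∧ Irreducible (R j))
    (hinj : Function.Injective R)
    (r : ℕ) (hr : 3 ≤ r)
    (Q : Fin r → Polynomial (ZMod p)) (hQ : ∀ j, Q j ≠ 0) :
    ∃ K γ : ℝ, 0 < K ∧ 0 < γ ∧
      ∀ D : Finset (Fin d → ℕ), D.Nonempty →
        ({A : Fin r → Fin d → ℕ | (∀ j, A j ∈ D) ∧ cumulantA R Q A ≠ 0}.ncard : ℝ)
        ≤ K * (D.card : ℝ) ^ (((r : ℝ) - 1) / 2) *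
            (1 + Real.log (1 + (funDiam D : ℝ))) ^ γ := by
  have hp : 2 ≤ p := (Fact.out : p.Prime).two_le
  obtain ⟨B, g, c, hcount⟩ :=
    exists_ncard_cumulantA_ne_zero_le (by omega : 0 < r) hR hinj hQ
  refine ⟨(B + 1) * ((c : ℝ) + 2) ^ g, g + 1, by positivity, by positivity, fun D hD => ?_⟩
  obtain ⟨n, hn, hnlog⟩ := exists_lt_pow_and_le_log hp (funDiam D) c
  set l := Real.log (1 + (funDiam D : ℝ)) with hl
  have hl0 : 0 ≤ l := Real.log_nonneg (by simp)
  have hD1 : (1 : ℝ) ≤ D.card := by exact_mod_cast hD.card_pos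
  have hr' : (3 : ℝ) ≤ r := by exact_mod_cast hr
  have hDpow : (D.card : ℝ) ≤ (D.card : ℝ) ^ (((r : ℝ) - 1) / 2) := by
    conv_lhs => rw [← Real.rpow_one (D.card : ℝ)]
    exact Real.rpow_le_rpow_of_exponent_le hD1 (by linarith)
  have hlpow : (1 + l) ^ g ≤ (1 + l) ^ ((g : ℝ) + 1) := by
    rw [← Real.rpow_natCast]
    exact Real.rpow_le_rpow_of_exponent_le (by linarith) (by linarith)
  calc ({A : Fin r → Fin d → ℕ | (∀ j, A j ∈ D) ∧ cumulantA R Q A ≠ 0}.ncard : ℝ)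
      ≤ D.card * (B * ((n : ℝ) + 1) ^ g) := by exact_mod_cast hcount D n hn
    _ ≤ (D.card : ℝ) ^ (((r : ℝ) - 1) / 2) * ((B + 1) * ((c + 2) * (1 + l)) ^ g) := by
        gcongr
        linarith
    _ = (B + 1) * ((c : ℝ) + 2) ^ g * (D.card : ℝ) ^ (((r : ℝ) - 1) / 2) * (1 + l) ^ g := by
        rw [mul_pow]; ring
    _ ≤ (B + 1) * ((c : ℝ) + 2) ^ g * (D.card : ℝ) ^ (((r : ℝ) - 1) / 2) *
          (1 + l) ^ ((g : ℝ) + 1) := by gcongr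
end
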